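/- arXiv:1906.08790 — 2 statements merged into one kernel-verified Lean document; each statement's English description precedes it below -/
import Mathlib

section
/- Let n ≥ 1, let N = e₁ be the first standard basis vector of ℝ^{2n}, and let S^{2n-1} denote the unit sphere of ℝ^{2n}. The orbit map θ_N : SO(2n) → S^{2n-1}, A ↦ A·N, induces a nonzero map on (2n-1)-st singular homology with real coefficients, θ_{N*} : H_{2n-1}(SO(2n); ℝ) → H_{2n-1}(S^{2n-1}; ℝ) ≅ ℝ. (Hence the transitive SO(2n)-action on the odd-dimensional sphere S^{2n-1} admits no homotopy comoment map.) -/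
open CategoryTheory

/-- The singular chain complex functor with real coefficients, defined via the singular
simplicial set. -/
noncomputable def singularChainComplexFunctor : TopCat.{0} ⥤ ChainComplex (ModuleCat.{0} ℝ) ℕ :=
  TopCat.toSSet ⋙ ((SimplicialObject.whiskering _ _).obj (ModuleCat.free ℝ)) ⋙
    AlgebraicTopology.alternatingFaceMapComplex _

/-- Singular homology with real coefficients, as a functor `TopCat ⥤ ModuleCat ℝ`. -/
noncomputable def singularHomologyFunctor (n : ℕ) : TopCat.{0} ⥤ ModuleCat.{0} ℝ :=
  singularChainComplexFunctor ⋙ HomologicalComplex.homologyFunctor _ _ n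

/-- The simplicial coboundary of a function on `p`-tuples. -/
noncomputable def cofaceSum {E : Type*} {p : ℕ} (c : (Fin p → E) → ℝ) (v : Fin (p + 1) → E) : ℝ :=
  ∑ i : Fin (p + 1), (-1) ^ (i : ℕ) * c (v ∘ i.succAbove)

/-- The barycenter of a tuple of points. -/
noncomputable def tupleBarycenter {E : Type*} [AddCommGroup E] [Module ℝ E] {p : ℕ}
    (v : Fin p → E) : E :=
  (p : ℝ)⁻¹ • ∑ i, v i

/-- The transpose of barycentric subdivision, acting on functions of `p`-tuples. -/
noncomputable def subdiv {E : Type*} [AddCommGroup E] [Module ℝ E] :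
    (p : ℕ) → ((Fin p → E) → ℝ) → (Fin p → E) → ℝ
  | 0, c, v => c v
  | p + 1, c, v => cofaceSum (subdiv p fun t ↦ c (Fin.cons (tupleBarycenter v) t)) v

section cofaceSum

variable {E : Type*} {p : ℕ}

lemma cofaceSum_sub (c c' : (Fin p → E) → ℝ) :
    cofaceSum (c - c') = cofaceSum c - cofaceSum c' := by
  ext v
  simp [cofaceSum, mul_sub]

lemma cofaceSum_const_smul (a : ℝ) (c : (Fin p → E) → ℝ) :
    cofaceSum (a • c) = a • cofaceSum c := by
  ext v
  simp [cofaceSum, Finset.mul_sum, mul_left_comm]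

lemma cofaceSum_cons_zero (c : (Fin 0 → E) → ℝ) (b : E) (t : Fin 0 → E) :
    cofaceSum c (Fin.cons b t) = c t := by
  simp [cofaceSum, Subsingleton.elim _ t]

lemma cofaceSum_cons (c : (Fin (p + 1) → E) → ℝ) (b : E) (t : Fin (p + 1) → E) :
    cofaceSum c (Fin.cons b t) = c t - cofaceSum (fun s ↦ c (Fin.cons b s)) t := by
  have h (i : Fin (p + 1)) :
      (Fin.cons b t : Fin (p + 2) → E) ∘ i.succ.succAbove = Fin.cons b (t ∘ i.succAbove) := by
    ext j
    refine Fin.cases ?_ (fun j ↦ ?_) j <;> simp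
  have h0 : (Fin.cons b t : Fin (p + 2) → E) ∘ (0 : Fin (p + 2)).succAbove = t := by
    ext j
    simp
  rw [cofaceSum, Fin.sum_univ_succ, h0]
  simp [h, cofaceSum, pow_succ, sub_eq_add_neg]

lemma cofaceSum_cofaceSum (c : (Fin p → E) → ℝ) : cofaceSum (cofaceSum c) = 0 := by
  induction p with
  | zero =>
    ext v
    rw [← Fin.cons_self_tail v, cofaceSum_cons]
    simp [cofaceSum]
  | succ p ih =>
    ext v
    rw [← Fin.cons_self_tail v, cofaceSum_cons]
    have h : (fun s ↦ cofaceSum c (Fin.cons (v 0) s)) =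
        c - cofaceSum (fun s ↦ c (Fin.cons (v 0) s)) := by
      ext s
      exact cofaceSum_cons c _ s
    rw [h, cofaceSum_sub, ih]
    simp

end cofaceSum

section subdiv

variable {E F : Type*} [AddCommGroup E] [Module ℝ E] [AddCommGroup F] [Module ℝ F] {p : ℕ}

lemma subdiv_sub (c c' : (Fin p → E) → ℝ) : subdiv p (c - c') = subdiv p c - subdiv p c' := by
  induction p with
  | zero => rfl
  | succ p ih =>
    ext v
    simp only [subdiv, Pi.sub_apply]
    rw [← Pi.sub_apply, ← cofaceSum_sub, ← ih]
    rfl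

lemma subdiv_const_smul (a : ℝ) (c : (Fin p → E) → ℝ) : subdiv p (a • c) = a • subdiv p c := by
  induction p with
  | zero => rfl
  | succ p ih =>
    ext v
    simp only [subdiv, Pi.smul_apply]
    rw [← Pi.smul_apply, ← cofaceSum_const_smul, ← ih]
    rfl

lemma subdiv_cofaceSum (c : (Fin p → E) → ℝ) :
    subdiv (p + 1) (cofaceSum c) = cofaceSum (subdiv p c) := by
  induction p with
  | zero =>
    ext v
    simp only [subdiv, cofaceSum_cons_zero]
  | succ p ih =>
    ext v
    have h : (fun t ↦ cofaceSum c (Fin.cons (tupleBarycenter v) t)) =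
        c - cofaceSum (fun s ↦ c (Fin.cons (tupleBarycenter v) s)) := by
      ext s
      exact cofaceSum_cons c _ s
    rw [subdiv, h, subdiv_sub, ih, cofaceSum_sub, cofaceSum_cofaceSum, sub_zero]

lemma subdiv_comp (f : E →ₗ[ℝ] F) (c : (Fin p → F) → ℝ) :
    subdiv p (fun t ↦ c (f ∘ t)) = fun v ↦ subdiv p c (f ∘ v) := by
  induction p with
  | zero => rfl
  | succ p ih =>
    ext v
    have h (t : Fin p → E) : f ∘ (Fin.cons (tupleBarycenter v) t : Fin (p + 1) → E) =
        Fin.cons (tupleBarycenter (f ∘ v)) (f ∘ t) := by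
      ext j
      refine Fin.cases ?_ (fun j ↦ ?_) j <;> simp [tupleBarycenter]
    simp only [subdiv, h]
    rw [ih fun t ↦ c (Fin.cons (tupleBarycenter (f ∘ v)) t)]
    rfl

lemma iterate_subdiv_cofaceSum (k : ℕ) (c : (Fin p → E) → ℝ) :
    (subdiv (p + 1))^[k] (cofaceSum c) = cofaceSum ((subdiv p)^[k] c) := by
  induction k with
  | zero => rfl
  | succ k ih => rw [Function.iterate_succ_apply', ih, subdiv_cofaceSum,
      Function.iterate_succ_apply']

lemma iterate_subdiv_const_smul (k : ℕ) (a : ℝ) (c : (Fin p → E) → ℝ) :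
    (subdiv p)^[k] (a • c) = a • (subdiv p)^[k] c := by
  induction k with
  | zero => rfl
  | succ k ih => rw [Function.iterate_succ_apply', ih, subdiv_const_smul,
      Function.iterate_succ_apply']

lemma iterate_subdiv_zero (k : ℕ) : (subdiv p)^[k] (0 : (Fin p → E) → ℝ) = 0 := by
  simpa using iterate_subdiv_const_smul k 0 (0 : (Fin p → E) → ℝ)

lemma iterate_subdiv_comp (k : ℕ) (f : E →ₗ[ℝ] F) (c : (Fin p → F) → ℝ) :
    (subdiv p)^[k] (fun t ↦ c (f ∘ t)) = fun v ↦ (subdiv p)^[k] c (f ∘ v) := by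
  induction k with
  | zero => rfl
  | succ k ih => rw [Function.iterate_succ_apply', ih, subdiv_comp, Function.iterate_succ_apply']

end subdiv

section locality

variable {E : Type*} [NormedAddCommGroup E] [NormedSpace ℝ E] {p : ℕ}

lemma tupleBarycenter_mem {S : Set E} (hS : Convex ℝ S) {v : Fin (p + 1) → E}
    (hv : ∀ i, v i ∈ S) : tupleBarycenter v ∈ S := by
  rw [tupleBarycenter, Finset.smul_sum]
  refine hS.sum_mem (fun _ _ ↦ by positivity) ?_ fun i _ ↦ hv i
  simp
  field_simp

lemma dist_tupleBarycenter_le {v : Fin (p + 1) → E} {D : ℝ} (hv : ∀ i j, dist (v i) (v j) ≤ D)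
    (i : Fin (p + 1)) : dist (v i) (tupleBarycenter v) ≤ p / (p + 1) * D := by
  have h : v i - tupleBarycenter v = ((p : ℝ) + 1)⁻¹ • ∑ j, (v i - v j) := by
    rw [Finset.sum_sub_distrib, smul_sub, tupleBarycenter]
    simp [← Nat.cast_smul_eq_nsmul ℝ, smul_smul]
    rw [inv_mul_cancel₀ (by positivity), one_smul]
  have h2 : ∑ j, ‖v i - v j‖ ≤ p * D := by
    rw [Fin.sum_univ_succAbove _ i]
    simp only [sub_self, norm_zero, zero_add]
    refine (Finset.sum_le_sum fun j _ ↦ (dist_eq_norm (v i) _).symm.trans_le (hv i _)).trans ?_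
    simp
  rw [dist_eq_norm, h, norm_smul, Real.norm_of_nonneg (by positivity)]
  calc _ ≤ ((p : ℝ) + 1)⁻¹ * (p * D) := by
        gcongr
        exact (norm_sum_le _ _).trans h2
    _ = _ := by ring

lemma subdiv_congr {κ D : ℝ} {S : Set E} (hS : Convex ℝ S) (hκ : (p : ℝ) ≤ κ * (p + 1))
    {c c' : (Fin p → E) → ℝ} {v : Fin p → E} (hvS : ∀ i, v i ∈ S)
    (hvD : ∀ i j, dist (v i) (v j) ≤ D)
    (h : ∀ t : Fin p → E, (∀ i, t i ∈ S) → (∀ i j, dist (t i) (t j) ≤ κ * D) → c t = c' t) :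
    subdiv p c v = subdiv p c' v := by
  induction p generalizing S with
  | zero => exact h v hvS fun i ↦ i.elim0
  | succ p ih =>
    have hD : 0 ≤ D := by simpa using hvD 0 0
    have hκ' : (p : ℝ) ≤ κ * (p + 1) := by
      push_cast at hκ
      have : (p : ℝ) + 1 ≤ κ * (p + 1) + κ := by linarith
      by_contra! hlt
      have h1 : 1 < κ := by linarith
      nlinarith [(Nat.cast_nonneg p : (0 : ℝ) ≤ p)]
    have hκ0 : 0 ≤ κ := by
      by_contra! hlt
      nlinarith [(Nat.cast_nonneg p : (0 : ℝ) ≤ p)]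
    have hb : tupleBarycenter v ∈ S := tupleBarycenter_mem hS hvS
    have hvb (i) : dist (v i) (tupleBarycenter v) ≤ κ * D := by
      refine (dist_tupleBarycenter_le hvD i).trans ?_
      gcongr
      rw [div_le_iff₀ (by positivity)]
      exact hκ'
    simp only [subdiv, cofaceSum]
    refine Finset.sum_congr rfl fun i _ ↦ ?_
    congr 1
    refine ih (hS.inter (convex_closedBall (tupleBarycenter v) (κ * D))) hκ'
      (fun j ↦ ⟨hvS _, hvb _⟩) (fun _ _ ↦ hvD _ _) fun t htS htD ↦ h _ ?_ ?_
    · intro j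
      refine Fin.cases ?_ (fun j ↦ ?_) j
      · simpa
      · simpa using (htS j).1
    · intro j l
      refine Fin.cases ?_ (fun j ↦ ?_) j <;> refine Fin.cases ?_ (fun l ↦ ?_) l
      · simp; positivity
      · simpa [dist_comm] using (htS l).2
      · simpa using (htS j).2
      · simpa using htD j l

lemma iterate_subdiv_congr {κ D : ℝ} {S : Set E} (hS : Convex ℝ S) (hκ : (p : ℝ) ≤ κ * (p + 1))
    (k : ℕ) {c c' : (Fin p → E) → ℝ} {v : Fin p → E} (hvS : ∀ i, v i ∈ S)
    (hvD : ∀ i j, dist (v i) (v j) ≤ D)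
    (h : ∀ t : Fin p → E, (∀ i, t i ∈ S) → (∀ i j, dist (t i) (t j) ≤ κ ^ k * D) → c t = c' t) :
    (subdiv p)^[k] c v = (subdiv p)^[k] c' v := by
  induction k generalizing v D with
  | zero => exact h v hvS (by simpa)
  | succ k ih =>
    rw [Function.iterate_succ_apply', Function.iterate_succ_apply']
    refine subdiv_congr hS hκ hvS hvD fun t htS htD ↦ ih htS htD fun s hsS hsD ↦ h s hsS ?_
    simpa [pow_succ, mul_assoc] using hsD

/-- Fine iterated subdivisions of `v` only see tuples of small mesh in any convex set
containing `v`. -/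
lemma eventually_iterate_subdiv_congr {S : Set E} (hS : Convex ℝ S) {c c' : (Fin p → E) → ℝ}
    {v : Fin p → E} (hvS : ∀ i, v i ∈ S) {ε : ℝ} (hε : 0 < ε)
    (h : ∀ t : Fin p → E, (∀ i, t i ∈ S) → (∀ i j, dist (t i) (t j) ≤ ε) → c t = c' t) :
    ∀ᶠ k : ℕ in Filter.atTop, (subdiv p)^[k] c v = (subdiv p)^[k] c' v := by
  obtain ⟨D, hD⟩ : ∃ D, ∀ i j, dist (v i) (v j) ≤ D := by
    obtain ⟨D, hD⟩ := (Set.finite_range fun q : Fin p × Fin p ↦ dist (v q.1) (v q.2)).bddAbove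
    exact ⟨D, fun i j ↦ hD ⟨(i, j), rfl⟩⟩
  have hlim : Filter.Tendsto (fun k : ℕ ↦ ((p : ℝ) / (p + 1)) ^ k * D) Filter.atTop (nhds 0) := by
    rw [← zero_mul D]
    refine (tendsto_pow_atTop_nhds_zero_of_lt_one (by positivity) ?_).mul_const D
    rw [div_lt_one (by positivity)]
    linarith
  filter_upwards [hlim.eventually (eventually_le_nhds hε)] with k hk
  refine iterate_subdiv_congr hS (κ := p / (p + 1)) (by field_simp; rfl) k hvS hD
    fun t htS htD ↦ h t htS fun i j ↦ (htD i j).trans hk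

end locality

/-- The signed indicator of the tuples of labels which are permutations of `0, …, p - 1`. -/
noncomputable def labelCount (p : ℕ) (l : Fin p → ℕ) : ℝ :=
  Matrix.det (Matrix.of fun i j : Fin p ↦ if l i = j then (1 : ℝ) else 0)

section labelCount

variable {p : ℕ}

lemma labelCount_eq_zero_of_forall_ne {l : Fin p → ℕ} (j : Fin p) (h : ∀ i, l i ≠ j) :
    labelCount p l = 0 :=
  Matrix.det_eq_zero_of_column_eq_zero j (by simpa)

lemma labelCount_eq_zero_of_le {l : Fin p → ℕ} (i : Fin p) (h : p ≤ l i) : labelCount p l = 0 :=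
  Matrix.det_eq_zero_of_row_eq_zero i fun j ↦ by
    simp only [Matrix.of_apply, ite_eq_right_iff, one_ne_zero, imp_false]
    omega

lemma exists_eq_of_labelCount_ne_zero {l : Fin p → ℕ} (h : labelCount p l ≠ 0) (j : Fin p) :
    ∃ i, l i = j := by
  by_contra! hj
  exact h (labelCount_eq_zero_of_forall_ne j hj)

lemma cofaceSum_labelCount {l : Fin (p + 1) → ℕ} (hl : ∀ i, l i ≤ p) :
    cofaceSum (labelCount p) l = (-1) ^ p * labelCount (p + 1) l := by
  set M : Matrix (Fin (p + 1)) (Fin (p + 1)) ℝ := Matrix.of fun i j ↦ if l i = j then 1 else 0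
  have h1 := Matrix.det_updateCol_sum M (Fin.last p) (fun _ ↦ 1)
  have hcol (i) : ∑ j, (1 : ℝ) • M i j = 1 := by
    simp only [M, Matrix.of_apply, one_smul]
    rw [Finset.sum_eq_single (⟨l i, Nat.lt_succ_of_le (hl i)⟩ : Fin (p + 1))]
    · simp
    · intro j _ hj
      simp only [ite_eq_right_iff, one_ne_zero, imp_false]
      exact fun h ↦ hj (Fin.ext h.symm)
    · simp
  rw [show labelCount (p + 1) l = M.det from rfl, ← one_smul ℝ M.det, ← h1,
    Matrix.det_succ_column _ (Fin.last p), Finset.mul_sum]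
  refine Finset.sum_congr rfl fun i _ ↦ ?_
  simp only [hcol, Matrix.updateCol_self, Fin.val_last, mul_one]
  have hs : (-1 : ℝ) ^ p * (-1) ^ ((i : ℕ) + p) = (-1) ^ (i : ℕ) := by
    rw [pow_add, mul_left_comm, ← pow_add, Even.neg_one_pow ⟨p, rfl⟩, mul_one]
  rw [← mul_assoc, hs]
  congr 1
  rw [labelCount]
  congr 1
  ext j k
  simp [M, Fin.succAbove_last, Fin.castSucc_ne_last]

end labelCount

section Sperner

variable {E : Type*} [NormedAddCommGroup E] [NormedSpace ℝ E] {q : ℕ}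

lemma iterate_subdiv_congr_of_convex {S : Set E} (hS : Convex ℝ S) (k : ℕ)
    {c c' : (Fin q → E) → ℝ} {v : Fin q → E} (hvS : ∀ i, v i ∈ S)
    (h : ∀ t : Fin q → E, (∀ i, t i ∈ S) → c t = c' t) :
    (subdiv q)^[k] c v = (subdiv q)^[k] c' v := by
  obtain ⟨D, hD⟩ := (Set.finite_range fun r : Fin q × Fin q ↦ dist (v r.1) (v r.2)).bddAbove
  exact iterate_subdiv_congr hS (κ := 1) (by linarith) k hvS
    (fun i j ↦ hD ⟨(i, j), rfl⟩) fun t htS _ ↦ h t htS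

/-- The signed number of the simplices of the `k`-th subdivision of `v` whose vertices are labelled
`0, …, q - 1`. -/
noncomputable def fullCellCount (q k : ℕ) (L : E → ℕ) (v : Fin q → E) : ℝ :=
  (subdiv q)^[k] (fun t ↦ labelCount q (L ∘ t)) v

lemma fullCellCount_zero (k : ℕ) (L : E → ℕ) (v : Fin 0 → E) : fullCellCount 0 k L v = 1 := by
  have h : (subdiv (E := E) 0)^[k] = id := by
    induction k with
    | zero => rfl
    | succ k ih => rw [Function.iterate_succ', ih]; rfl
  simp [fullCellCount, h, labelCount]

lemma fullCellCount_eq_zero {S : Set E} (hS : Convex ℝ S) (k : ℕ) {L : E → ℕ} {v : Fin q → E}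
    (hvS : ∀ i, v i ∈ S) (j : Fin q) (hL : ∀ x ∈ S, L x ≠ j) : fullCellCount q k L v = 0 := by
  have := iterate_subdiv_congr_of_convex hS k (c := fun t ↦ labelCount q (L ∘ t)) (c' := 0) hvS
    fun t ht ↦ labelCount_eq_zero_of_forall_ne j fun i ↦ hL _ (ht i)
  rw [fullCellCount, this, iterate_subdiv_zero, Pi.zero_apply]

lemma cofaceSum_fullCellCount (k : ℕ) (L : E → ℕ) (v : Fin (q + 1) → E) :
    cofaceSum (fullCellCount q k L) v =
      (subdiv (q + 1))^[k] (fun t ↦ cofaceSum (labelCount q) (L ∘ t)) v := by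
  have : (fun t ↦ cofaceSum (labelCount q) (L ∘ t)) =
      cofaceSum fun t : Fin q → E ↦ labelCount q (L ∘ t) := rfl
  rw [this, iterate_subdiv_cofaceSum]
  rfl

lemma fullCellCount_succ {S : Set E} (hS : Convex ℝ S) (k : ℕ) {L : E → ℕ}
    {v : Fin (q + 1) → E} (hvS : ∀ i, v i ∈ S) (hL : ∀ x ∈ S, L x ≤ q) :
    fullCellCount (q + 1) k L v = (-1) ^ q * cofaceSum (fullCellCount q k L) v := by
  have hc : (subdiv (q + 1))^[k] (fun t ↦ cofaceSum (labelCount q) (L ∘ t)) v =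
      (subdiv (q + 1))^[k] (((-1 : ℝ) ^ q) • fun t ↦ labelCount (q + 1) (L ∘ t)) v :=
    iterate_subdiv_congr_of_convex hS k hvS fun t ht ↦ by
      exact cofaceSum_labelCount fun i ↦ hL _ (ht i)
  rw [cofaceSum_fullCellCount, hc, iterate_subdiv_const_smul, Pi.smul_apply, smul_eq_mul,
    ← mul_assoc, ← pow_add, Even.neg_one_pow ⟨q, rfl⟩, one_mul]
  rfl

variable {m : ℕ}

lemma convex_stdSimplex_inter (T : Set (Fin (m + 1))) :
    Convex ℝ {x ∈ stdSimplex ℝ (Fin (m + 1)) | ∀ i ∈ T, x i = 0} := by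
  refine (convex_stdSimplex ℝ _).inter fun x hx y hy a b _ _ _ i hi ↦ ?_
  simp [hx i hi, hy i hi]

lemma single_mem_stdSimplex_inter {T : Set (Fin (m + 1))} {j : Fin (m + 1)} (hj : j ∉ T) :
    (Pi.single j 1 : Fin (m + 1) → ℝ) ∈
      {x ∈ stdSimplex ℝ (Fin (m + 1)) | ∀ i ∈ T, x i = 0} :=
  ⟨single_mem_stdSimplex ℝ j, fun i hi ↦ Pi.single_eq_of_ne (by rintro rfl; exact hj hi) _⟩

/-- Sperner's lemma. -/
lemma fullCellCount_eq_one_of_sperner {L : (Fin (m + 1) → ℝ) → ℕ}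
    (hL : ∀ x ∈ stdSimplex ℝ (Fin (m + 1)), ∃ i : Fin (m + 1), (i : ℕ) = L x ∧ x i ≠ 0)
    (k : ℕ) {q : ℕ} (hq : q ≤ m + 1) :
    fullCellCount q k L (fun i ↦ Pi.single (Fin.castLE hq i) 1) = 1 := by
  induction q with
  | zero =>
    exact fullCellCount_zero k L _
  | succ q ih =>
    rw [fullCellCount_succ (convex_stdSimplex_inter {i | q < i}) k
      (fun i ↦ single_mem_stdSimplex_inter (by simp; omega))]
    · rw [cofaceSum, Fin.sum_univ_castSucc, Finset.sum_eq_zero, zero_add, Fin.val_last,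
        ← mul_assoc, ← pow_add, Even.neg_one_pow ⟨q, rfl⟩, one_mul]
      · convert ih (by omega) using 2
        ext i : 1
        simp [Fin.succAbove_last]
      · intro i _
        refine mul_eq_zero_of_right _ <| fullCellCount_eq_zero
          (convex_stdSimplex_inter {Fin.castLE hq i.castSucc}) k
          (fun j ↦ single_mem_stdSimplex_inter ?_) i ?_
        · simp only [Set.mem_singleton_iff, Fin.ext_iff, Fin.val_castLE]
          exact fun h ↦ Fin.succAbove_ne i.castSucc j (Fin.ext h)
        · rintro x ⟨hx, hx0⟩ h
          obtain ⟨l, hl, hne⟩ := hL x hx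
          refine hne (hx0 l ?_)
          simp [Fin.ext_iff, hl, h]
    · rintro x ⟨hx, hx0⟩
      obtain ⟨l, hl, hne⟩ := hL x hx
      by_contra! hlt
      exact hne (hx0 l (by simp; omega))

/-- The first index at which `g` is nonpositive. -/
noncomputable def firstNonpos (g : Fin (m + 1) → ℝ) : ℕ :=
  sInf {n | ∃ i : Fin (m + 1), (i : ℕ) = n ∧ g i ≤ 0}

lemma firstNonpos_le {g : Fin (m + 1) → ℝ} {i : Fin (m + 1)} (h : g i ≤ 0) : firstNonpos g ≤ i :=
  Nat.sInf_le ⟨i, rfl, h⟩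

lemma exists_eq_firstNonpos {g : Fin (m + 1) → ℝ} (h : ∃ i, g i ≤ 0) :
    ∃ i : Fin (m + 1), (i : ℕ) = firstNonpos g ∧ g i ≤ 0 :=
  Nat.sInf_mem (s := {n | ∃ i : Fin (m + 1), (i : ℕ) = n ∧ g i ≤ 0})
    (h.elim fun i hi ↦ ⟨i, i, rfl, hi⟩)

lemma nonpos_of_firstNonpos_eq {g : Fin (m + 1) → ℝ} (h : ∃ i, g i ≤ 0) {i : Fin (m + 1)}
    (hi : firstNonpos g = i) : g i ≤ 0 := by
  obtain ⟨j, hj, hg⟩ := exists_eq_firstNonpos h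
  rwa [show i = j from Fin.ext (by omega)]

lemma firstNonpos_lt {g : Fin (m + 1) → ℝ} (h : ∃ i, g i ≤ 0) : firstNonpos g < m + 1 := by
  obtain ⟨j, hj, -⟩ := exists_eq_firstNonpos h
  omega

lemma firstNonpos_congr {g g' : Fin (m + 1) → ℝ} (h : ∀ i, g i ≤ 0 ↔ g' i ≤ 0) :
    firstNonpos g = firstNonpos g' := by
  simp only [firstNonpos, h]

lemma exists_sub_average_nonpos (x : Fin (m + 1) → ℝ) :
    ∃ i, x i - (∑ j, x j) / (m + 1) ≤ 0 := by
  obtain ⟨i, -, hi⟩ := Finset.exists_le_of_sum_le (s := Finset.univ) (f := x)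
    (g := fun _ ↦ (∑ j, x j) / (m + 1)) Finset.univ_nonempty (by simp; field_simp; rfl)
  exact ⟨i, by linarith⟩

lemma exists_average_sub_nonpos (x : Fin (m + 1) → ℝ) :
    ∃ i, (∑ j, x j) / (m + 1) - x i ≤ 0 := by
  obtain ⟨i, hi⟩ := exists_sub_average_nonpos (-x)
  refine ⟨i, ?_⟩
  simp only [Pi.neg_apply, Finset.sum_neg_distrib, neg_div] at hi
  linarith

/-- The first barycentric coordinate which is at most average. -/
noncomputable def lowLabel (x : Fin (m + 1) → ℝ) : ℕ := firstNonpos fun i ↦ x i - 1 / (m + 1)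

/-- The first barycentric coordinate which is at least average. -/
noncomputable def highLabel (x : Fin (m + 1) → ℝ) : ℕ := firstNonpos fun i ↦ 1 / (m + 1) - x i

section

variable {x : Fin (m + 1) → ℝ}

lemma exists_low (hx : x ∈ stdSimplex ℝ (Fin (m + 1))) : ∃ i, x i - 1 / (m + 1) ≤ 0 :=
  hx.2 ▸ exists_sub_average_nonpos x

lemma exists_high (hx : x ∈ stdSimplex ℝ (Fin (m + 1))) : ∃ i, 1 / (m + 1) - x i ≤ 0 :=
  hx.2 ▸ exists_average_sub_nonpos x

end

lemma fullCellCount_highLabel (k : ℕ) :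
    fullCellCount (m + 1) k highLabel (fun i : Fin (m + 1) ↦ Pi.single i 1) = 1 := by
  refine fullCellCount_eq_one_of_sperner (fun x hx ↦ ?_) k le_rfl
  obtain ⟨i, hi, h⟩ := exists_eq_firstNonpos (exists_high hx)
  refine ⟨i, hi, fun h0 ↦ ?_⟩
  rw [h0] at h
  have : (0 : ℝ) < 1 / (m + 1) := by positivity
  linarith

/-- The index of the `i`-th vertex of the face spanned by `0, …, q - 1` and the last vertex. -/
def faceIndex (m q : ℕ) (hq : q ≤ m) (i : Fin (q + 1)) : Fin (m + 1) :=
  if (i : ℕ) < q then ⟨i, by omega⟩ else Fin.last m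

lemma fullCellCount_lowLabel_faceIndex (k : ℕ) {q : ℕ} (hq : q ≤ m) :
    fullCellCount (q + 1) k lowLabel (fun i ↦ Pi.single (faceIndex m q hq i) 1) =
      (-1) ^ q * cofaceSum (fullCellCount q k lowLabel)
        (fun i ↦ Pi.single (faceIndex m q hq i) 1) := by
  refine fullCellCount_succ (convex_stdSimplex_inter {i | q ≤ i ∧ (i : ℕ) < m}) k
    (fun i ↦ single_mem_stdSimplex_inter ?_) ?_
  · simp only [faceIndex, Set.mem_ofPred_eq]
    split_ifs <;> simp; omega
  · rintro x ⟨hx, hx0⟩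
    obtain rfl | hlt := hq.eq_or_lt
    · exact Nat.lt_succ_iff.1 (firstNonpos_lt (exists_low hx))
    · refine firstNonpos_le (i := ⟨q, by omega⟩) ?_
      rw [hx0 _ ⟨le_rfl, hlt⟩]
      have : (0 : ℝ) < 1 / (m + 1) := by positivity
      linarith

lemma eventually_fullCellCount_lowLabel_castLE {q : ℕ} (hq : q + 1 ≤ m) :
    ∀ᶠ k in Filter.atTop, fullCellCount (q + 1) k lowLabel
      (fun i ↦ Pi.single (Fin.castLE (by omega : q + 1 ≤ m + 1) i) 1) = 0 := by
  have hm : (0 : ℝ) < m := by exact_mod_cast (by omega : 0 < m)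
  have hε : (0 : ℝ) < 1 / (2 * m * (m + 1)) := by positivity
  have hv (i : Fin (q + 1)) : (Pi.single (Fin.castLE (by omega : q + 1 ≤ m + 1) i) 1 :
      Fin (m + 1) → ℝ) ∈ {x ∈ stdSimplex ℝ (Fin (m + 1)) | ∀ i ∈ {i | q < i.val}, x i = 0} :=
    single_mem_stdSimplex_inter (by simp; omega)
  refine (eventually_iterate_subdiv_congr (convex_stdSimplex_inter _) (c' := 0) hv hε
    fun t htS ht ↦ ?_).mono
    fun k hk ↦ by rw [fullCellCount, hk, iterate_subdiv_zero, Pi.zero_apply]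
  by_contra hne
  have hle (i : Fin m) : t 0 i.castSucc ≤ 1 / (m + 1) + 1 / (2 * m * (m + 1)) := by
    by_cases hi : (i : ℕ) < q + 1
    · obtain ⟨j, hj⟩ := exists_eq_of_labelCount_ne_zero hne ⟨i, hi⟩
      have h1 := nonpos_of_firstNonpos_eq (exists_low (htS j).1) (i := i.castSucc) hj
      have h2 := (le_abs_self _).trans ((dist_le_pi_dist (t 0) (t j) i.castSucc).trans (ht 0 j))
      linarith
    · rw [(htS 0).2 _ (by simp; omega)]
      positivity
  have hsum := (htS 0).1.2
  rw [Fin.sum_univ_castSucc, (htS 0).2 (Fin.last m) (by simp; omega), add_zero] at hsum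
  have := Finset.sum_le_sum fun i (_ : i ∈ Finset.univ) ↦ hle i
  rw [hsum] at this
  simp at this
  field_simp at this
  linarith

lemma eventually_fullCellCount_lowLabel_face {q : ℕ} (hq : q ≤ m) :
    ∀ᶠ k in Filter.atTop, fullCellCount (q + 1) k lowLabel
      (fun i ↦ Pi.single (faceIndex m q hq i) 1) = (-1) ^ q := by
  induction q with
  | zero =>
    refine .of_forall fun k ↦ ?_
    rw [fullCellCount_lowLabel_faceIndex]
    simp [cofaceSum, fullCellCount_zero]
  | succ q ih =>
    filter_upwards [ih (by omega), eventually_fullCellCount_lowLabel_castLE hq] with k hk hk0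
    rw [fullCellCount_lowLabel_faceIndex, cofaceSum, Fin.sum_univ_castSucc, Fin.sum_univ_castSucc,
      Finset.sum_eq_zero, zero_add]
    · have h1 : (fun i ↦ (Pi.single (faceIndex m (q + 1) hq i) 1 : Fin (m + 1) → ℝ)) ∘
          (Fin.last (q + 1)).succAbove =
          fun i : Fin (q + 1) ↦ Pi.single (Fin.castLE (by omega : q + 1 ≤ m + 1) i) 1 := by
        ext i : 1
        have : (i : ℕ) ≤ q := i.is_le
        simp [Fin.succAbove_last, faceIndex, Fin.castLE, this]
      have h2 : (fun i ↦ (Pi.single (faceIndex m (q + 1) hq i) 1 : Fin (m + 1) → ℝ)) ∘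
          (Fin.last q).castSucc.succAbove =
          fun i : Fin (q + 1) ↦ Pi.single (faceIndex m q (by omega) i) 1 := by
        ext i : 1
        have : faceIndex m (q + 1) hq ((Fin.last q).castSucc.succAbove i) =
            faceIndex m q (by omega) i := by
          obtain hi | rfl := i.le_last.lt_or_eq
          · have : (i : ℕ) < q := hi
            simp [faceIndex, Fin.succAbove_of_castSucc_lt _ _ (Fin.castSucc_lt_castSucc_iff.2 hi),
              this, this.le]
          · simp [faceIndex]
        rw [Function.comp_apply, this]
      rw [h1, h2, hk, hk0]
      simp [← pow_add, Even.neg_one_pow ⟨q, rfl⟩]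
    · intro i _
      refine mul_eq_zero_of_right _ <| fullCellCount_eq_zero
        (convex_stdSimplex_inter {(⟨i, by omega⟩ : Fin (m + 1))}) k
        (fun j ↦ single_mem_stdSimplex_inter ?_) (Fin.last q) ?_
      · have : (i.castSucc.castSucc.succAbove j : ℕ) ≠ i := fun h ↦
          Fin.succAbove_ne i.castSucc.castSucc j (Fin.ext h)
        simp only [faceIndex, Set.mem_singleton_iff]
        split_ifs <;> simp [Fin.ext_iff] <;> omega
      · rintro x ⟨hx, hx0⟩ h
        have h1 : lowLabel x ≤ i := firstNonpos_le (i := ⟨i, by omega⟩) <| by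
          rw [hx0 _ rfl]
          have : (0 : ℝ) < 1 / (m + 1) := by positivity
          linarith
        have := i.2
        rw [Fin.val_last] at h
        omega

lemma eventually_fullCellCount_lowLabel :
    ∀ᶠ k in Filter.atTop, fullCellCount (m + 1) k lowLabel
      (fun i : Fin (m + 1) ↦ Pi.single i 1) = (-1) ^ m := by
  convert eventually_fullCellCount_lowLabel_face (le_refl m) using 6 with k i
  simp only [faceIndex, Fin.ext_iff]
  split_ifs with h
  · rfl
  · simp only [Fin.val_last]
    omega

end Sperner

section SphereDegree

variable {m p : ℕ}

/-- A labelling of the points of a sphere by `0, …, m + 1`. -/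
noncomputable def sphereLabel (X : EuclideanSpace ℝ (Fin (m + 1))) : ℕ :=
  if 0 ≤ ∑ i, X i then m + 1 else firstNonpos fun i ↦ X i - (∑ j, X j) / (m + 1)

lemma sphereLabel_le (X : EuclideanSpace ℝ (Fin (m + 1))) : sphereLabel X ≤ m + 1 := by
  rw [sphereLabel]
  split_ifs
  · rfl
  · exact (firstNonpos_lt (exists_sub_average_nonpos X)).le

lemma sum_nonneg_of_sphereLabel_eq {X : EuclideanSpace ℝ (Fin (m + 1))}
    (h : sphereLabel X = m + 1) : 0 ≤ ∑ i, X i := by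
  by_contra hX
  rw [sphereLabel, if_neg hX] at h
  exact (firstNonpos_lt (exists_sub_average_nonpos X)).ne h

lemma nonpos_of_sphereLabel_eq {X : EuclideanSpace ℝ (Fin (m + 1))} {i : Fin (m + 1)}
    (h : sphereLabel X = i) : X i ≤ 0 := by
  rw [sphereLabel] at h
  split_ifs at h with hX
  · omega
  · have h1 := nonpos_of_firstNonpos_eq (exists_sub_average_nonpos X) h
    have h2 : (∑ j, X j) / (m + 1) ≤ 0 :=
      div_nonpos_of_nonpos_of_nonneg (not_le.1 hX).le (by positivity)
    linarith

lemma labelCount_sphereLabel_eq_zero {Y : Fin (m + 2) → EuclideanSpace ℝ (Fin (m + 1))}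
    (hY : ∀ i, ‖Y i‖ = 1) (hd : ∀ i j, dist (Y i) (Y j) ≤ 1 / (m + 2) ^ 2) :
    labelCount (m + 2) (sphereLabel ∘ Y) = 0 := by
  by_contra hne
  obtain ⟨j, hj⟩ := exists_eq_of_labelCount_ne_zero hne (Fin.last _)
  have hsum := sum_nonneg_of_sphereLabel_eq hj
  have hle (i : Fin (m + 1)) : Y j i ≤ 1 / (m + 2) ^ 2 := by
    obtain ⟨l, hl⟩ := exists_eq_of_labelCount_ne_zero hne i.castSucc
    have h1 := nonpos_of_sphereLabel_eq hl
    have h2 := (le_abs_self _).trans <| (PiLp.norm_apply_le (Y j - Y l) i).trans <|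
      (dist_eq_norm _ _).symm.trans_le (hd j l)
    rw [PiLp.sub_apply] at h2
    linarith
  have hge (i : Fin (m + 1)) : -(m / (m + 2) ^ 2) ≤ Y j i := by
    rw [Fin.sum_univ_succAbove _ i] at hsum
    have := Finset.sum_le_sum fun l (_ : l ∈ Finset.univ) ↦ hle (i.succAbove l)
    simp only [Finset.sum_const, Finset.card_univ, Fintype.card_fin, nsmul_eq_mul,
      mul_one_div] at this
    linarith
  have hsq (i : Fin (m + 1)) : ‖Y j i‖ ^ 2 ≤ (1 / (m + 2)) ^ 2 := by
    rw [Real.norm_eq_abs]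
    have h1 : (1 : ℝ) / (m + 2) ^ 2 ≤ 1 / (m + 2) := by
      gcongr
      nlinarith [(Nat.cast_nonneg m : (0 : ℝ) ≤ m)]
    have h2 : (m : ℝ) / (m + 2) ^ 2 ≤ 1 / (m + 2) := by
      rw [div_le_div_iff₀ (by positivity) (by positivity)]
      nlinarith [(Nat.cast_nonneg m : (0 : ℝ) ≤ m)]
    gcongr
    exact abs_le.2 ⟨by linarith [hge i], (hle i).trans h1⟩
  have h1 := EuclideanSpace.norm_sq_eq (Y j)
  have h2 := Finset.sum_le_sum fun l (_ : l ∈ Finset.univ) ↦ hsq l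
  rw [← h1, hY] at h2
  simp at h2
  field_simp at h2
  nlinarith [(Nat.cast_nonneg m : (0 : ℝ) ≤ m)]

open Classical in
/-- The labelling of the points of the standard simplex induced by a map to the sphere. -/
noncomputable def simplexLabel (f : stdSimplex ℝ (Fin (p + 1)) →
    Metric.sphere (0 : EuclideanSpace ℝ (Fin (m + 1))) 1) (y : Fin (p + 1) → ℝ) : ℕ :=
  if h : y ∈ stdSimplex ℝ (Fin (p + 1)) then sphereLabel (f ⟨y, h⟩).1 else 0

/-- The signed number of fully labelled cells of the `k`-th subdivision of a singular simplex of
the sphere. -/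
noncomputable def cellDegree (k : ℕ) (f : stdSimplex ℝ (Fin (m + 1)) →
    Metric.sphere (0 : EuclideanSpace ℝ (Fin (m + 1))) 1) : ℝ :=
  fullCellCount (m + 1) k (simplexLabel f) fun i ↦ Pi.single i 1

lemma cellDegree_comp_map (k : ℕ) (w : stdSimplex ℝ (Fin (m + 2)) →
    Metric.sphere (0 : EuclideanSpace ℝ (Fin (m + 1))) 1) (g : Fin (m + 1) → Fin (m + 2)) :
    cellDegree k (w ∘ stdSimplex.map g) =
      fullCellCount (m + 1) k (simplexLabel w) ((fun i ↦ Pi.single i 1) ∘ g) := by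
  have hv : (fun i ↦ (Pi.single i 1 : Fin (m + 2) → ℝ)) ∘ g =
      FunOnFinite.linearMap ℝ ℝ g ∘ fun i ↦ Pi.single i 1 := by
    ext i : 1
    simp [FunOnFinite.linearMap_piSingle]
  have h1 : cellDegree k (w ∘ stdSimplex.map g) =
      fullCellCount (m + 1) k (simplexLabel w ∘ FunOnFinite.linearMap ℝ ℝ g)
        fun i ↦ Pi.single i 1 := by
    refine iterate_subdiv_congr_of_convex (convex_stdSimplex ℝ _) k
      (fun i ↦ single_mem_stdSimplex ℝ i) fun t ht ↦ ?_
    have : simplexLabel (w ∘ stdSimplex.map g) ∘ t =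
        (simplexLabel w ∘ FunOnFinite.linearMap ℝ ℝ g) ∘ t := by
      ext i
      have : FunOnFinite.linearMap ℝ ℝ g (t i) ∈ stdSimplex ℝ (Fin (m + 2)) :=
        (stdSimplex.map g ⟨t i, ht i⟩).2
      simp only [Function.comp_apply, simplexLabel]
      rw [dif_pos (ht i), dif_pos this]
      rfl
    rw [this]
  rw [h1, hv]
  exact congrFun (iterate_subdiv_comp k (FunOnFinite.linearMap ℝ ℝ g)
    fun t ↦ labelCount (m + 1) (simplexLabel w ∘ t)) _

lemma eventually_sum_cellDegree_eq_zero (w : C(stdSimplex ℝ (Fin (m + 2)),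
    Metric.sphere (0 : EuclideanSpace ℝ (Fin (m + 1))) 1)) :
    ∀ᶠ k in Filter.atTop, ∑ i : Fin (m + 2),
      (-1) ^ (i : ℕ) * cellDegree k (w ∘ stdSimplex.map i.succAbove) = 0 := by
  have huc : UniformContinuous w := CompactSpace.uniformContinuous_of_continuous w.continuous
  obtain ⟨δ, hδ, h⟩ := Metric.uniformContinuous_iff.1 huc (1 / (m + 2) ^ 2) (by positivity)
  have := eventually_iterate_subdiv_congr (convex_stdSimplex ℝ (Fin (m + 2)))
    (c := fun t ↦ cofaceSum (labelCount (m + 1)) (simplexLabel w ∘ t)) (c' := 0)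
    (fun i ↦ single_mem_stdSimplex ℝ i) (half_pos hδ) fun t ht htd ↦ ?_
  · filter_upwards [this] with k hk
    simp only [cellDegree_comp_map]
    rw [iterate_subdiv_zero, ← cofaceSum_fullCellCount] at hk
    exact hk
  · have hl : simplexLabel w ∘ t = sphereLabel ∘ fun i ↦ (w ⟨t i, ht i⟩).1 := by
      ext i
      simp [simplexLabel, ht i]
    have hle (i) : (sphereLabel ∘ fun i ↦ (w ⟨t i, ht i⟩).1) i ≤ m + 1 := sphereLabel_le _
    rw [hl, cofaceSum_labelCount hle, labelCount_sphereLabel_eq_zero]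
    · simp
    · simp
    · intro i j
      exact (h ((htd i j).trans_lt (half_lt_self hδ))).le

end SphereDegree

section Homology

lemma homologyMap_ne_zero {C ι : Type*} [Category* C] [Abelian C] {c : ComplexShape ι}
    {K L : HomologicalComplex C c} (φ : K ⟶ L) {i j l : ι} (hj : c.next i = j) (hl : c.prev i = l)
    {A B : C} (k : A ⟶ K.X i) (hk : k ≫ K.d i j = 0) (g : L.X i ⟶ B) (hg : L.d l i ≫ g = 0)
    (h : k ≫ φ.f i ≫ g ≠ 0) : HomologicalComplex.homologyMap φ i ≠ 0 := by
  intro h0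
  apply h
  calc k ≫ φ.f i ≫ g = K.liftCycles k j hj hk ≫ K.homologyπ i ≫
        HomologicalComplex.homologyMap φ i ≫ L.homologyι i ≫ L.descOpcycles g l hl hg := by
        simp
    _ = 0 := by simp [h0]

lemma alternatingSum_apply {M N : ModuleCat.{0} ℝ} {q : ℕ} (f : Fin q → (M ⟶ N)) (x : M) :
    (∑ i : Fin q, (-1 : ℤ) ^ (i : ℕ) • f i) x = ∑ i : Fin q, (-1 : ℝ) ^ (i : ℕ) • f i x := by
  change (∑ i : Fin q, (-1 : ℤ) ^ (i : ℕ) • f i).hom x =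
    ∑ i : Fin q, (-1 : ℝ) ^ (i : ℕ) • (f i).hom x
  rw [ModuleCat.hom_sum, LinearMap.sum_apply]
  refine Finset.sum_congr rfl fun i _ ↦ ?_
  rw [ModuleCat.hom_zsmul, LinearMap.smul_apply, ← Int.cast_smul_eq_zsmul ℝ]
  push_cast
  rfl

variable {X Y : TopCat.{0}} {p : ℕ}

/-- The map of a standard simplex into the next induced by a map of vertices. -/
noncomputable def stdSimplexMap {p q : ℕ} (g : Fin p → Fin q) :
    C(stdSimplex ℝ (Fin p), stdSimplex ℝ (Fin q)) :=
  ⟨_, stdSimplex.continuous_map g⟩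

/-- The chain given by a single singular simplex. -/
noncomputable def singularChain (f : C(stdSimplex ℝ (Fin (p + 1)), X)) :
    (singularChainComplexFunctor.obj X).X p :=
  ModuleCat.freeMk (R := ℝ) ((TopCat.toSSetObjEquiv X (.op (.mk p))).symm f)

lemma map_singularChain (θ : X ⟶ Y) (f : C(stdSimplex ℝ (Fin (p + 1)), X)) :
    (singularChainComplexFunctor.map θ).f p (singularChain f) = singularChain (θ.hom.comp f) :=
  ModuleCat.free_map_apply _ _

lemma d_singularChain (f : C(stdSimplex ℝ (Fin (p + 2)), X)) :
    (singularChainComplexFunctor.obj X).d (p + 1) p (singularChain f) =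
      ∑ i : Fin (p + 2), (-1 : ℝ) ^ (i : ℕ) •
        singularChain (f.comp (stdSimplexMap i.succAbove)) := by
  have : (singularChainComplexFunctor.obj X).d (p + 1) p =
      ∑ i : Fin (p + 2), (-1 : ℤ) ^ (i : ℕ) • (ModuleCat.free ℝ).map ((TopCat.toSSet.obj X).δ i) :=
    AlgebraicTopology.alternatingFaceMapComplex_obj_d _ _
  refine (ConcreteCategory.congr_hom this _).trans <| (alternatingSum_apply _ _).trans ?_
  refine Finset.sum_congr rfl fun i _ ↦ congrArg _ ?_
  exact ModuleCat.free_map_apply _ _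

lemma exists_singularCochain {V : Type} [AddCommGroup V] [Module ℝ V]
    (φ : C(stdSimplex ℝ (Fin (p + 1)), X) → V) :
    ∃ g : (singularChainComplexFunctor.obj X).X p ⟶ ModuleCat.of ℝ V,
      ∀ f, g (singularChain f) = φ f :=
  ⟨ModuleCat.freeDesc (↾fun s ↦ φ (TopCat.toSSetObjEquiv X (.op (.mk p)) s)), fun f ↦ by
    refine (ModuleCat.freeDesc_apply _ _).trans ?_
    simp⟩

lemma hom_ext_singularChain {M : ModuleCat ℝ}
    {g g' : (singularChainComplexFunctor.obj X).X p ⟶ M}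
    (h : ∀ f, g (singularChain f) = g' (singularChain f)) : g = g' :=
  ModuleCat.free_hom_ext fun x ↦ by
    obtain ⟨f, rfl⟩ := (TopCat.toSSetObjEquiv X (.op (.mk p))).symm.surjective x
    exact h f

lemma singularHomologyFunctor_map_ne_zero {V : Type} [AddCommGroup V] [Module ℝ V] (θ : X ⟶ Y)
    (φ : C(stdSimplex ℝ (Fin (p + 2)), Y) → V)
    (hφ : ∀ w : C(stdSimplex ℝ (Fin (p + 3)), Y), ∑ i : Fin (p + 3),
      (-1 : ℝ) ^ (i : ℕ) • φ (w.comp (stdSimplexMap i.succAbove)) = 0)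
    {a b : C(stdSimplex ℝ (Fin (p + 2)), X)}
    (hab : ∀ i : Fin (p + 2), a.comp (stdSimplexMap i.succAbove) =
      b.comp (stdSimplexMap i.succAbove))
    (hne : φ (θ.hom.comp a) ≠ φ (θ.hom.comp b)) :
    (singularHomologyFunctor (p + 1)).map θ ≠ 0 := by
  obtain ⟨g, hg⟩ := exists_singularCochain φ
  obtain ⟨k, hk⟩ : ∃ k : ModuleCat.of ℝ ℝ ⟶ (singularChainComplexFunctor.obj X).X (p + 1),
      k (1 : ℝ) = singularChain a - singularChain b :=
    ⟨ModuleCat.ofHom (LinearMap.toSpanSingleton ℝ _ (singularChain a - singularChain b)),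
      one_smul ℝ _⟩
  refine homologyMap_ne_zero (singularChainComplexFunctor.map θ)
    (ChainComplex.next_nat_succ p) (ChainComplex.prev ℕ (p + 1)) k ?_ g ?_ ?_
  · ext
    simp [hk, d_singularChain, hab]
  · refine hom_ext_singularChain fun w ↦ ?_
    simp [d_singularChain, hg, hφ]
  · intro h
    have := ConcreteCategory.congr_hom h (1 : ℝ)
    simp [hk, map_singularChain, hg, sub_eq_zero] at this
    exact hne this

end Homology

section Labels

lemma singularHomologyFunctor_map_sphere_ne_zero {X : TopCat.{0}} {p : ℕ}
    (θ : X ⟶ TopCat.of (Metric.sphere (0 : EuclideanSpace ℝ (Fin (p + 2))) 1))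
    {a b : C(stdSimplex ℝ (Fin (p + 2)), X)}
    (hab : ∀ i : Fin (p + 2), a.comp (stdSimplexMap i.succAbove) =
      b.comp (stdSimplexMap i.succAbove))
    (ha : ∀ᶠ k in Filter.atTop, cellDegree k (θ ∘ a) = 1)
    (hb : ∀ᶠ k in Filter.atTop, cellDegree k (θ ∘ b) = -1) :
    (singularHomologyFunctor (p + 1)).map θ ≠ 0 := by
  refine singularHomologyFunctor_map_ne_zero (V := Filter.Germ (Filter.atTop : Filter ℕ) ℝ) θ
    (fun f ↦ ((fun k ↦ cellDegree (m := p + 1) k f : ℕ → ℝ) :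
      Filter.Germ (Filter.atTop : Filter ℕ) ℝ)) (fun w ↦ ?_) hab fun h ↦ ?_
  · have : (∑ i : Fin (p + 3), (-1 : ℝ) ^ (i : ℕ) •
        ((fun k ↦ cellDegree (m := p + 1) k (w.comp (stdSimplexMap i.succAbove)) : ℕ → ℝ) :
          Filter.Germ (Filter.atTop : Filter ℕ) ℝ)) =
        ((∑ i : Fin (p + 3), (-1 : ℝ) ^ (i : ℕ) •
          fun k ↦ cellDegree (m := p + 1) k (w.comp (stdSimplexMap i.succAbove)) : ℕ → ℝ) :
          Filter.Germ (Filter.atTop : Filter ℕ) ℝ) :=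
      (map_sum (Filter.Germ.coeAddHom (Filter.atTop : Filter ℕ) (M := ℝ)) _ _).symm
    rw [this]
    refine Filter.Germ.coe_eq.2 ?_
    filter_upwards [eventually_sum_cellDegree_eq_zero w] with k hk
    simp only [Finset.sum_apply, Pi.smul_apply, smul_eq_mul]
    exact hk
  · obtain ⟨k, h, ha, hb⟩ := ((Filter.Germ.coe_eq.1 h).and (ha.and hb)).exists
    have : (1 : ℝ) = -1 := ha.symm.trans (h.trans hb)
    norm_num at this

variable {m : ℕ}

/-- The first index at which the barycentric coordinate deviates from the average in the direction
of `σ`. -/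
noncomputable def deviationLabel (σ : ℝ) (y : Fin (m + 1) → ℝ) : ℕ :=
  firstNonpos fun i ↦ -(σ * (y i - 1 / (m + 1)))

lemma deviationLabel_one : deviationLabel (m := m) 1 = highLabel := by
  ext y
  exact firstNonpos_congr fun i ↦ by rw [one_mul, neg_sub]

lemma deviationLabel_neg_one : deviationLabel (m := m) (-1) = lowLabel := by
  ext y
  exact firstNonpos_congr fun i ↦ by rw [neg_one_mul, neg_neg]

lemma sum_sub_average {y : Fin (m + 1) → ℝ} (hy : y ∈ stdSimplex ℝ (Fin (m + 1))) :
    ∑ i, (y i - 1 / (m + 1)) = 0 := by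
  rw [Finset.sum_sub_distrib, hy.2]
  simp
  field_simp
  simp

lemma exists_deviationLabel_nonneg {σ : ℝ} {y : Fin (m + 1) → ℝ}
    (hy : y ∈ stdSimplex ℝ (Fin (m + 1))) : ∃ i, -(σ * (y i - 1 / (m + 1))) ≤ 0 := by
  have := exists_sub_average_nonpos fun i ↦ -(σ * (y i - 1 / (m + 1)))
  rw [Finset.sum_neg_distrib, ← Finset.mul_sum, sum_sub_average hy, mul_zero, neg_zero,
    zero_div] at this
  simpa only [sub_zero] using this

lemma abs_le_of_sum_eq_zero {u : Fin (m + 1) → ℝ} {ε : ℝ} (h : ∑ i, u i = 0)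
    (hu : ∀ i, -ε ≤ u i) (i : Fin (m + 1)) : |u i| ≤ (m + 1) * ε := by
  have hε : 0 ≤ ε := by
    have := Finset.sum_le_sum fun i (_ : i ∈ Finset.univ) ↦ hu i
    rw [h] at this
    simp at this
    nlinarith [(Nat.cast_nonneg m : (0 : ℝ) ≤ m)]
  rw [Fin.sum_univ_succAbove _ i] at h
  have := Finset.sum_le_sum fun l (_ : l ∈ Finset.univ) ↦ hu (i.succAbove l)
  simp at this
  have hm : (0 : ℝ) ≤ m * ε := by positivity
  exact abs_le.2 ⟨by linarith [hu i], by linarith⟩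

lemma abs_sub_average_le {σ ε : ℝ} (hσ : |σ| = 1) {t : Fin (m + 1) → Fin (m + 1) → ℝ}
    (ht : ∀ i, t i ∈ stdSimplex ℝ (Fin (m + 1))) (hd : ∀ i j, dist (t i) (t j) ≤ ε)
    (hne : labelCount (m + 1) (deviationLabel σ ∘ t) ≠ 0) (j i : Fin (m + 1)) :
    |t j i - 1 / (m + 1)| ≤ (m + 1) * ε := by
  have h := abs_le_of_sum_eq_zero (u := fun i ↦ σ * (t j i - 1 / (m + 1))) (ε := ε)
    (by rw [← Finset.mul_sum, sum_sub_average (ht j), mul_zero]) (fun i ↦ ?_) i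
  · rwa [abs_mul, hσ, one_mul] at h
  · obtain ⟨l, hl⟩ := exists_eq_of_labelCount_ne_zero hne i
    have h1 := nonpos_of_firstNonpos_eq (exists_deviationLabel_nonneg (ht l)) hl
    have h2 : |σ * (t l i - t j i)| ≤ ε := by
      rw [abs_mul, hσ, one_mul]
      exact (dist_le_pi_dist (t l) (t j) i).trans (hd l j)
    have := (abs_le.1 h2).2
    linarith

lemma eventually_fullCellCount_eq_deviationLabel {σ : ℝ} (hσ : |σ| = 1)
    {L : (Fin (m + 1) → ℝ) → ℕ} {O : Set (Fin (m + 1) → ℝ)}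
    (hO : ∀ᶠ y in nhds fun _ : Fin (m + 1) ↦ (1 : ℝ) / (m + 1), y ∉ O)
    (h1 : ∀ y ∈ stdSimplex ℝ (Fin (m + 1)), y ∉ O → L y = deviationLabel σ y)
    (h2 : ∀ y ∈ stdSimplex ℝ (Fin (m + 1)), y ∈ O → L y = m + 1) :
    ∀ᶠ k in Filter.atTop, fullCellCount (m + 1) k L (fun i : Fin (m + 1) ↦ Pi.single i 1) =
      fullCellCount (m + 1) k (deviationLabel σ) (fun i : Fin (m + 1) ↦ Pi.single i 1) := by
  obtain ⟨δ, hδ, hO⟩ := Metric.eventually_nhds_iff.1 hO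
  refine eventually_iterate_subdiv_congr (convex_stdSimplex ℝ (Fin (m + 1)))
    (fun i ↦ single_mem_stdSimplex ℝ i) (ε := δ / (2 * (m + 1))) (by positivity)
    fun t ht htd ↦ ?_
  by_cases hne : labelCount (m + 1) (deviationLabel σ ∘ t) = 0
  · by_cases h : ∀ i, t i ∉ O
    · exact congrArg _ (funext fun i ↦ h1 _ (ht i) (h i))
    · push Not at h
      obtain ⟨i, hi⟩ := h
      rw [hne]
      exact labelCount_eq_zero_of_le i (h2 _ (ht i) hi).ge
  · refine congrArg _ (funext fun i ↦ h1 _ (ht i) (hO ?_))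
    refine ((dist_pi_le_iff (by positivity : 0 ≤ δ / 2)).2 fun j ↦ ?_).trans_lt (half_lt_self hδ)
    refine (abs_sub_average_le hσ ht htd hne i j).trans_eq ?_
    field_simp

end Labels

section Reflection

variable {n : Type*} [Fintype n] [DecidableEq n]

/-- The matrix of the reflection in the hyperplane orthogonal to `x`. -/
noncomputable def householder (x : n → ℝ) : Matrix n n ℝ :=
  1 - (2 / (x ⬝ᵥ x)) • Matrix.vecMulVec x x

lemma householder_mulVec (x u : n → ℝ) :
    (householder x).mulVec u = u - (2 * (x ⬝ᵥ u) / (x ⬝ᵥ x)) • x := by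
  rw [householder, Matrix.sub_mulVec, Matrix.one_mulVec, Matrix.smul_mulVec,
    Matrix.vecMulVec_mulVec, op_smul_eq_smul, smul_smul]
  ring_nf

lemma householder_mul_self {x : n → ℝ} (hx : x ⬝ᵥ x ≠ 0) : householder x * householder x = 1 := by
  refine Matrix.ext_of_mulVec_single fun i ↦ ?_
  have h (a : ℝ) : 2 * a / (x ⬝ᵥ x) + 2 * (a - 2 * a / (x ⬝ᵥ x) * (x ⬝ᵥ x)) / (x ⬝ᵥ x) = 0 := by
    rw [div_mul_cancel₀ _ hx]
    ring
  rw [← Matrix.mulVec_mulVec, householder_mulVec, householder_mulVec, Matrix.one_mulVec,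
    dotProduct_sub, dotProduct_smul, sub_sub, ← add_smul, smul_eq_mul, h, zero_smul, sub_zero]

lemma householder_transpose (x : n → ℝ) : (householder x).transpose = householder x := by
  simp [householder, Matrix.transpose_vecMulVec]

lemma det_householder {x : n → ℝ} (hx : x ⬝ᵥ x ≠ 0) : (householder x).det = -1 := by
  rw [householder, ← Matrix.smul_vecMulVec, Matrix.vecMulVec_eq Unit, Matrix.det_one_sub_mul_comm]
  rw [Matrix.det_unique, Matrix.sub_apply, Matrix.one_apply_eq, Matrix.mul_apply,
    show ∑ j, Matrix.replicateRow Unit x default j *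
      Matrix.replicateCol Unit ((2 / (x ⬝ᵥ x)) • x) j default =
      x ⬝ᵥ ((2 / (x ⬝ᵥ x)) • x) from rfl, dotProduct_smul, smul_eq_mul, div_mul_cancel₀ _ hx]
  norm_num

lemma householder_mul_householder_mem {x w : n → ℝ} (hx : x ⬝ᵥ x ≠ 0) (hw : w ⬝ᵥ w ≠ 0) :
    householder x * householder w ∈ Matrix.specialOrthogonalGroup n ℝ := by
  have h {x : n → ℝ} (hx : x ⬝ᵥ x ≠ 0) : householder x ∈ Matrix.orthogonalGroup n ℝ := by
    rw [Matrix.mem_orthogonalGroup_iff, householder_transpose, householder_mul_self hx]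
  refine Matrix.mem_specialOrthogonalGroup_iff.2 ⟨mul_mem (h hx) (h hw), ?_⟩
  rw [Matrix.det_mul, det_householder hx, det_householder hw]
  norm_num

lemma continuousOn_householder : ContinuousOn (householder (n := n)) {x | x ⬝ᵥ x ≠ 0} := by
  unfold householder
  refine continuousOn_const.sub (ContinuousOn.smul (continuousOn_const.div ?_ fun x hx ↦ hx) ?_)
  · fun_prop
  · fun_prop

end Reflection

section Cycle

variable {m : ℕ}

/-- The unit vector with equal coordinates. -/
noncomputable def diagonalVector (m : ℕ) : Fin (m + 1) → ℝ := fun _ ↦ 1 / √(m + 1)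

/-- The normal of a hyperplane whose reflection maps the first basis vector to the diagonal. -/
noncomputable def diagonalNormal (m : ℕ) : Fin (m + 1) → ℝ := Pi.single 0 1 - diagonalVector m

lemma diagonalVector_dotProduct_self : diagonalVector m ⬝ᵥ diagonalVector m = 1 := by
  have : √((m : ℝ) + 1) ^ 2 = m + 1 := Real.sq_sqrt (by positivity)
  simp [diagonalVector, dotProduct]
  field_simp
  exact this.symm

lemma diagonalNormal_dotProduct_self :
    diagonalNormal m ⬝ᵥ diagonalNormal m = 2 * (1 - 1 / √(m + 1)) := by
  simp only [diagonalNormal, dotProduct_sub, sub_dotProduct, diagonalVector_dotProduct_self]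
  simp [diagonalVector]
  ring

lemma diagonalNormal_dotProduct_self_ne_zero (hm : m ≠ 0) :
    diagonalNormal m ⬝ᵥ diagonalNormal m ≠ 0 := by
  have : (1 : ℝ) < √(m + 1) := by
    rw [Real.lt_sqrt (by norm_num)]
    have : (0 : ℝ) < m := by positivity
    linarith
  have : 1 / √((m : ℝ) + 1) < 1 := by rwa [div_lt_one (by positivity)]
  rw [diagonalNormal_dotProduct_self]
  linarith

lemma householder_diagonalNormal_mulVec (hm : m ≠ 0) :
    (householder (diagonalNormal m)).mulVec (Pi.single 0 1) = diagonalVector m := by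
  have h : 2 * (diagonalNormal m ⬝ᵥ Pi.single 0 1) = diagonalNormal m ⬝ᵥ diagonalNormal m := by
    rw [diagonalNormal_dotProduct_self]
    simp [diagonalNormal, diagonalVector]
  rw [householder_mulVec, h, div_self (diagonalNormal_dotProduct_self_ne_zero hm), one_smul,
    diagonalNormal]
  abel

/-- A family of vectors, parametrized by the simplex, pushed in the diagonal direction away from the
boundary. -/
noncomputable def pushedVector (σ : ℝ) (y : Fin (m + 1) → ℝ) : Fin (m + 1) → ℝ :=
  fun i ↦ σ * ∏ j, y j + (y i - 1 / (m + 1))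

section

variable {y : Fin (m + 1) → ℝ}

lemma sum_pushedVector (σ : ℝ) (hy : y ∈ stdSimplex ℝ (Fin (m + 1))) :
    ∑ i, pushedVector σ y i = (m + 1) * (σ * ∏ j, y j) := by
  simp only [pushedVector]
  rw [Finset.sum_add_distrib, sum_sub_average hy]
  simp

lemma pushedVector_dotProduct_self (σ : ℝ) (hy : y ∈ stdSimplex ℝ (Fin (m + 1))) :
    pushedVector σ y ⬝ᵥ pushedVector σ y =
      (m + 1) * (σ * ∏ j, y j) ^ 2 + ∑ i, (y i - 1 / (m + 1)) ^ 2 := by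
  have h (i) : pushedVector σ y i * pushedVector σ y i = (σ * ∏ j, y j) ^ 2 +
      2 * (σ * ∏ j, y j) * (y i - 1 / (m + 1)) + (y i - 1 / (m + 1)) ^ 2 := by
    rw [pushedVector]
    ring
  simp only [dotProduct, h]
  rw [Finset.sum_add_distrib, Finset.sum_add_distrib, ← Finset.mul_sum, sum_sub_average hy]
  simp

lemma pushedVector_dotProduct_self_pos {σ : ℝ} (hσ : σ ≠ 0)
    (hy : y ∈ stdSimplex ℝ (Fin (m + 1))) : 0 < pushedVector σ y ⬝ᵥ pushedVector σ y := by
  rw [pushedVector_dotProduct_self σ hy]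
  have hs : 0 ≤ ∑ i, (y i - 1 / (m + 1)) ^ 2 := Finset.sum_nonneg fun i _ ↦ sq_nonneg _
  obtain hs | hs := hs.lt_or_eq
  · positivity
  · have h (i) : y i = 1 / (m + 1) := by
      have := (Finset.sum_eq_zero_iff_of_nonneg fun i _ ↦ sq_nonneg _).1 hs.symm i
        (Finset.mem_univ i)
      exact sub_eq_zero.1 (pow_eq_zero_iff two_ne_zero |>.1 this)
    have : ∏ j, y j ≠ 0 := Finset.prod_ne_zero_iff.2 fun i _ ↦ by rw [h]; positivity
    rw [← hs]
    positivity

/-- The region of the simplex where `pushedVector` is far from the diagonal. -/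
def outerRegion (m : ℕ) : Set (Fin (m + 1) → ℝ) :=
  {y | (m + 1) * (∏ j, y j) ^ 2 ≤ ∑ i, (y i - 1 / (m + 1)) ^ 2}

lemma eventually_notMem_outerRegion :
    ∀ᶠ y in nhds fun _ : Fin (m + 1) ↦ (1 : ℝ) / (m + 1), y ∉ outerRegion m := by
  simp only [outerRegion, Set.mem_ofPred_eq, not_le]
  refine ContinuousAt.eventually_lt
    (continuous_finsetSum _ fun i _ ↦ by fun_prop).continuousAt (by fun_prop) ?_
  simp
  positivity

lemma sphereLabel_reflection {σ : ℝ} (hσ : |σ| = 1) (hy : y ∈ stdSimplex ℝ (Fin (m + 1)))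
    {X : EuclideanSpace ℝ (Fin (m + 1))}
    (hX : ⇑X = (householder (pushedVector σ y)).mulVec (diagonalVector m)) :
    (y ∉ outerRegion m → sphereLabel X = deviationLabel σ y) ∧
      (y ∈ outerRegion m → sphereLabel X = m + 1) := by
  have hσ2 : σ ^ 2 = 1 := by rw [← sq_abs, hσ, one_pow]
  have hσ0 : σ ≠ 0 := by rintro rfl; simp at hσ
  have hQ := pushedVector_dotProduct_self_pos hσ0 hy
  have hdot : pushedVector σ y ⬝ᵥ diagonalVector m =
      (m + 1) * (σ * ∏ j, y j) * (1 / √(m + 1)) := by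
    rw [← sum_pushedVector σ hy, Finset.sum_mul]
    rfl
  have hXi (i) : X i = 1 / √(m + 1) - 2 * ((m + 1) * (σ * ∏ j, y j) * (1 / √(m + 1))) /
      (pushedVector σ y ⬝ᵥ pushedVector σ y) * pushedVector σ y i := by
    rw [hX, householder_mulVec, hdot]
    rfl
  have hsum : ∑ i, X i = (m + 1) * (1 / √(m + 1)) /
      (pushedVector σ y ⬝ᵥ pushedVector σ y) *
        (∑ i, (y i - 1 / (m + 1)) ^ 2 - (m + 1) * (∏ j, y j) ^ 2) := by
    simp only [hXi]
    rw [Finset.sum_sub_distrib, ← Finset.mul_sum, sum_pushedVector σ hy]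
    have h := pushedVector_dotProduct_self σ hy
    rw [mul_pow, hσ2, one_mul] at h
    have h' : ∑ i, (y i - 1 / (m + 1)) ^ 2 = pushedVector σ y ⬝ᵥ pushedVector σ y -
      (m + 1) * (∏ j, y j) ^ 2 := by linarith
    rw [h']
    simp
    field_simp
    linear_combination (-2 * (∏ j, y j) ^ 2 * (m + 1)) * hσ2
  have hiff : 0 ≤ ∑ i, X i ↔ y ∈ outerRegion m := by
    rw [hsum, mul_nonneg_iff_of_pos_left (by positivity), sub_nonneg]
    rfl
  refine ⟨fun h ↦ ?_, fun h ↦ if_pos (hiff.2 h)⟩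
  rw [sphereLabel, if_neg (hiff.not.2 h)]
  refine firstNonpos_congr fun i ↦ ?_
  have hα0 : ∏ j, y j ≠ 0 := by
    intro h0
    refine h ?_
    simp only [outerRegion, Set.mem_ofPred_eq, h0]
    simpa using Finset.sum_nonneg fun i _ ↦ sq_nonneg _
  have hα : 0 < ∏ j, y j := lt_of_le_of_ne (Finset.prod_nonneg fun i _ ↦ hy.1 i) hα0.symm
  have hXm : X i - (∑ j, X j) / (m + 1) = 2 * ((m + 1) * (∏ j, y j) * (1 / √(m + 1))) /
      (pushedVector σ y ⬝ᵥ pushedVector σ y) * -(σ * (y i - 1 / (m + 1))) := by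
    simp only [hXi]
    rw [Finset.sum_sub_distrib, ← Finset.mul_sum, sum_pushedVector σ hy]
    simp [pushedVector]
    field_simp
    ring
  rw [hXm]
  rw [← not_lt, ← not_lt, mul_pos_iff_of_pos_left (by positivity)]

end

end Cycle

section OrbitMap

variable {m : ℕ}

/-- A singular simplex of the special orthogonal group consisting of products of two reflections. -/
noncomputable def orthogonalSimplex (hm : m ≠ 0) (σ : ℝ) (hσ : σ ≠ 0) :
    C(stdSimplex ℝ (Fin (m + 1)), Matrix.specialOrthogonalGroup (Fin (m + 1)) ℝ) where
  toFun y := ⟨householder (pushedVector σ y) * householder (diagonalNormal m),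
    householder_mul_householder_mem (pushedVector_dotProduct_self_pos hσ y.2).ne'
      (diagonalNormal_dotProduct_self_ne_zero hm)⟩
  continuous_toFun := by
    have h : Continuous fun y : stdSimplex ℝ (Fin (m + 1)) ↦ pushedVector σ y := by
      have h (i : Fin (m + 1)) : Continuous fun y : stdSimplex ℝ (Fin (m + 1)) ↦ (y : _ → ℝ) i :=
        (continuous_apply i).comp continuous_subtype_val
      exact continuous_pi fun i ↦ (continuous_const.mul
        (continuous_finsetProd _ fun j _ ↦ h j)).add ((h i).sub continuous_const)
    refine Continuous.subtype_mk (Continuous.mul ?_ continuous_const) _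
    exact continuousOn_householder.comp_continuous h fun y ↦
      (pushedVector_dotProduct_self_pos hσ y.2).ne'

lemma stdSimplexMap_succAbove_apply_self (i : Fin (m + 1)) (y : stdSimplex ℝ (Fin m)) :
    stdSimplexMap i.succAbove y i = 0 := by
  change FunOnFinite.linearMap ℝ ℝ i.succAbove y i = 0
  rw [FunOnFinite.linearMap_apply_apply]
  refine Finset.sum_eq_zero fun j hj ↦ ?_
  exact absurd (Finset.mem_filter.1 hj).2 (Fin.succAbove_ne i j)

lemma orthogonalSimplex_comp_stdSimplexMap (hm : m ≠ 0) {σ τ : ℝ} (hσ : σ ≠ 0) (hτ : τ ≠ 0)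
    (i : Fin (m + 1)) :
    (orthogonalSimplex hm σ hσ).comp (stdSimplexMap i.succAbove) =
      (orthogonalSimplex hm τ hτ).comp (stdSimplexMap i.succAbove) := by
  ext1 y
  have h (σ : ℝ) : pushedVector σ (stdSimplexMap i.succAbove y) =
      fun j ↦ stdSimplexMap i.succAbove y j - 1 / (m + 1) := by
    have : ∏ j, stdSimplexMap i.succAbove y j = 0 :=
      Finset.prod_eq_zero (Finset.mem_univ i) (stdSimplexMap_succAbove_apply_self i y)
    ext j
    simp only [pushedVector, this, mul_zero, zero_add]
  refine Subtype.ext ?_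
  change householder (pushedVector σ (stdSimplexMap i.succAbove y)) * _ =
    householder (pushedVector τ (stdSimplexMap i.succAbove y)) * _
  rw [h, h]

lemma eventually_cellDegree_orthogonalSimplex (hm : m ≠ 0) {σ : ℝ} (hσ : σ ≠ 0) (hσ1 : |σ| = 1)
    {θ : Matrix.specialOrthogonalGroup (Fin (m + 1)) ℝ →
      Metric.sphere (0 : EuclideanSpace ℝ (Fin (m + 1))) 1}
    (hθ : ∀ A, ⇑(θ A).1 = A.1.mulVec (Pi.single 0 1)) :
    ∀ᶠ k in Filter.atTop, cellDegree k (θ ∘ orthogonalSimplex hm σ hσ) =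
      fullCellCount (m + 1) k (deviationLabel σ) (fun i : Fin (m + 1) ↦ Pi.single i 1) := by
  have h (y : stdSimplex ℝ (Fin (m + 1))) := sphereLabel_reflection hσ1 y.2
    (X := (θ (orthogonalSimplex hm σ hσ y)).1) <| by
      rw [hθ, ← householder_diagonalNormal_mulVec hm, Matrix.mulVec_mulVec]
      rfl
  refine eventually_fullCellCount_eq_deviationLabel hσ1 eventually_notMem_outerRegion
    (fun y hy hO ↦ ?_) fun y hy hO ↦ ?_
  · rw [simplexLabel, dif_pos hy]
    exact (h ⟨y, hy⟩).1 hO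
  · rw [simplexLabel, dif_pos hy]
    exact (h ⟨y, hy⟩).2 hO

lemma singularHomologyFunctor_map_orbitMap_ne_zero {p : ℕ} (hp : Even p)
    (θ : TopCat.of (Matrix.specialOrthogonalGroup (Fin (p + 2)) ℝ) ⟶
      TopCat.of (Metric.sphere (0 : EuclideanSpace ℝ (Fin (p + 2))) 1))
    (hθ : ∀ A : Matrix.specialOrthogonalGroup (Fin (p + 2)) ℝ,
      ⇑(Subtype.val (θ A)) = A.1.mulVec (Pi.single 0 1)) :
    (singularHomologyFunctor (p + 1)).map θ ≠ 0 := by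
  have h1 := eventually_cellDegree_orthogonalSimplex p.succ_ne_zero one_ne_zero abs_one hθ
  have h2 := eventually_cellDegree_orthogonalSimplex p.succ_ne_zero (neg_ne_zero.2 one_ne_zero)
    (by rw [abs_neg, abs_one]) hθ
  refine singularHomologyFunctor_map_sphere_ne_zero θ
    (orthogonalSimplex_comp_stdSimplexMap p.succ_ne_zero one_ne_zero (neg_ne_zero.2 one_ne_zero))
    ?_ ?_
  · filter_upwards [h1] with k hk
    rw [deviationLabel_one, fullCellCount_highLabel] at hk
    exact hk
  · filter_upwards [h2, eventually_fullCellCount_lowLabel] with k hk hk'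
    rw [deviationLabel_neg_one, hk', hp.add_one.neg_one_pow] at hk
    exact hk

end OrbitMap

/-- the orbit map `θ_N : SO(2n) → S^{2n-1}`, `A ↦ A·e₁`, induces a nonzero map on
`(2n-1)`-st singular homology with real coefficients. -/
theorem SO_even_orbitMap_nonzero_on_homology
    (n : ℕ) (hn : 1 ≤ n)
    (θ : TopCat.of (Matrix.specialOrthogonalGroup (Fin (2 * n)) ℝ) ⟶
      TopCat.of (Metric.sphere (0 : EuclideanSpace ℝ (Fin (2 * n))) 1))
    (hθ : ∀ A : Matrix.specialOrthogonalGroup (Fin (2 * n)) ℝ,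
      Subtype.val (θ A) =
        (A : Matrix (Fin (2 * n)) (Fin (2 * n)) ℝ).mulVec
          (EuclideanSpace.single (⟨0, by omega⟩ : Fin (2 * n)) (1 : ℝ))) :
    (singularHomologyFunctor (2 * n - 1)).map θ ≠ 0 := by
  obtain ⟨n, rfl⟩ := Nat.exists_eq_add_of_le' hn
  refine singularHomologyFunctor_map_orbitMap_ne_zero (even_two_mul n) θ fun A ↦ (hθ A).trans ?_
  congr 1
end

section
/- Let n ≥ 1, let N = e₁ be the first standard basis vector of ℝ^{2n+1}, and let S^{2n} denote the unit sphere of ℝ^{2n+1}. The orbit map θ_N : SO(2n+1) → S^{2n}, A ↦ A·N, induces the zero map on 2n-th singular homology with real coefficients, θ_{N*} = 0 : H_{2n}(SO(2n+1); ℝ) → H_{2n}(S^{2n}; ℝ). (Dually, the pullback under θ_N of the fundamental cohomology class of S^{2n} vanishes in H^{2n}(SO(2n+1); ℝ); this is the key step showing that the transitive SO(2n+1)-action on the even-dimensional sphere S^{2n} does admit a homotopy comoment map, in contrast to the odd-sphere case.) -/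
open CategoryTheory

/-! ### Ordered chains on a type and their barycentric subdivision -/

/-- Real chains on `j`-tuples of points of `V`; the degree is shifted by one, so that degree `0`
is the augmentation. -/
abbrev TupleChain (V : Type) (j : ℕ) : Type := (Fin j → V) →₀ ℝ

namespace TupleChain

variable {V W : Type}

/-- The alternating sum of the faces of a tuple. -/
noncomputable def boundary (j : ℕ) : TupleChain V (j + 1) →ₗ[ℝ] TupleChain V j :=
  ∑ i : Fin (j + 1), (-1 : ℝ) ^ (i : ℕ) • Finsupp.lmapDomain ℝ ℝ fun p => p ∘ i.succAbove

/-- The cone with apex `v` over a chain. -/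
noncomputable def cone (v : V) (j : ℕ) : TupleChain V j →ₗ[ℝ] TupleChain V (j + 1) :=
  Finsupp.lmapDomain ℝ ℝ fun p => Fin.cons v p

/-- The map on chains induced by a map of points. -/
noncomputable def map (f : V → W) (j : ℕ) : TupleChain V j →ₗ[ℝ] TupleChain W j :=
  Finsupp.lmapDomain ℝ ℝ fun p => f ∘ p

lemma boundary_single {j : ℕ} (p : Fin (j + 1) → V) :
    boundary j (Finsupp.single p 1) =
      ∑ i : Fin (j + 1), (-1 : ℝ) ^ (i : ℕ) • Finsupp.single (p ∘ i.succAbove) 1 := by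
  simp [boundary, LinearMap.sum_apply]

lemma cone_single {j : ℕ} (v : V) (p : Fin j → V) :
    cone v j (Finsupp.single p 1) = Finsupp.single (Fin.cons v p) 1 := by
  simp [cone]

lemma map_single {j : ℕ} (f : V → W) (p : Fin j → V) :
    map f j (Finsupp.single p 1) = Finsupp.single (f ∘ p) 1 := by
  simp [map]

lemma hom_ext {j : ℕ} {M : Type*} [AddCommGroup M] [Module ℝ M] {f g : TupleChain V j →ₗ[ℝ] M}
    (h : ∀ p, f (Finsupp.single p 1) = g (Finsupp.single p 1)) : f = g :=
  Finsupp.lhom_ext' fun p => LinearMap.ext_ring (h p)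

lemma boundary_cone_zero (v : V) : boundary 0 ∘ₗ cone v 0 = LinearMap.id := by
  refine hom_ext fun p => ?_
  simp [cone_single, boundary_single]

lemma boundary_cone (v : V) (j : ℕ) :
    boundary (j + 1) ∘ₗ cone v (j + 1) = LinearMap.id - cone v j ∘ₗ boundary j := by
  refine hom_ext fun p => ?_
  have h0 : (Fin.cons v p : Fin (j + 2) → V) ∘ Fin.succ = p := by ext; simp
  have hs (i : Fin (j + 1)) : (Fin.cons v p : Fin (j + 2) → V) ∘ i.succ.succAbove =
      Fin.cons v (p ∘ i.succAbove) := by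
    ext a
    refine Fin.cases ?_ (fun a => ?_) a <;> simp
  simp [cone_single, boundary_single, Fin.sum_univ_succ (n := j + 1), h0, hs, pow_succ,
    sub_eq_add_neg, -Finsupp.smul_single]

lemma boundary_boundary (j : ℕ) : boundary j ∘ₗ boundary (V := V) (j + 1) = 0 := by
  induction j with
  | zero =>
    refine hom_ext fun p => ?_
    rw [← Fin.cons_self_tail p, ← cone_single]
    have h := LinearMap.congr_fun (boundary_cone (p 0) 0) (Finsupp.single (Fin.tail p) 1)
    simp only [LinearMap.comp_apply, LinearMap.sub_apply, LinearMap.id_apply] at h ⊢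
    rw [h, map_sub, ← LinearMap.comp_apply, boundary_cone_zero]
    simp
  | succ j ih =>
    refine hom_ext fun p => ?_
    rw [← Fin.cons_self_tail p, ← cone_single]
    have h := LinearMap.congr_fun (boundary_cone (p 0) (j + 1)) (Finsupp.single (Fin.tail p) 1)
    have h' := LinearMap.congr_fun (boundary_cone (p 0) j)
      (boundary (j + 1) (Finsupp.single (Fin.tail p) 1))
    have h'' := LinearMap.congr_fun ih (Finsupp.single (Fin.tail p) 1)
    simp only [LinearMap.comp_apply, LinearMap.sub_apply, LinearMap.id_apply,
      LinearMap.zero_apply] at h h' h'' ⊢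
    rw [h, map_sub, h', h'']
    simp

lemma map_boundary (f : V → W) (j : ℕ) :
    map f j ∘ₗ boundary j = boundary j ∘ₗ map f (j + 1) := by
  refine hom_ext fun p => ?_
  simp [boundary_single, map_single, Function.comp_assoc, -Finsupp.smul_single]

lemma map_cone (f : V → W) (v : V) (j : ℕ) (c : TupleChain V j) :
    map f (j + 1) (cone v j c) = cone (f v) j (map f j c) := by
  suffices map f (j + 1) ∘ₗ cone v j = cone (f v) j ∘ₗ map f j from LinearMap.congr_fun this c
  refine hom_ext fun p => ?_
  simp [cone_single, map_single, Fin.comp_cons]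

section Subdivision

variable (b : ∀ j : ℕ, (Fin (j + 1) → V) → V)

/-- The subdivision operator obtained by coning off over the points `b`. -/
noncomputable def sd : ∀ j : ℕ, TupleChain V j →ₗ[ℝ] TupleChain V j
  | 0 => LinearMap.id
  | j + 1 => Finsupp.lift _ ℝ _ fun p => cone (b j p) j (sd j (boundary j (Finsupp.single p 1)))

/-- The chain homotopy between the identity and the subdivision operator. -/
noncomputable def sdHomotopy : ∀ j : ℕ, TupleChain V j →ₗ[ℝ] TupleChain V (j + 1)
  | 0 => 0
  | j + 1 => Finsupp.lift _ ℝ _ fun p => cone (b j p) (j + 1)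
      (Finsupp.single p 1 - sdHomotopy j (boundary j (Finsupp.single p 1)))

lemma sd_single {j : ℕ} (p : Fin (j + 1) → V) : sd b (j + 1) (Finsupp.single p 1) =
    cone (b j p) j (sd b j (boundary j (Finsupp.single p 1))) := by
  simp [sd]

lemma sdHomotopy_single {j : ℕ} (p : Fin (j + 1) → V) :
    sdHomotopy b (j + 1) (Finsupp.single p 1) = cone (b j p) (j + 1)
      (Finsupp.single p 1 - sdHomotopy b j (boundary j (Finsupp.single p 1))) := by
  simp [sdHomotopy]

lemma boundary_sdHomotopy (j : ℕ) :
    boundary (j + 1) ∘ₗ sdHomotopy b (j + 1) =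
      LinearMap.id - sd b (j + 1) - sdHomotopy b j ∘ₗ boundary j := by
  refine hom_ext fun p => ?_
  have key : boundary j (sdHomotopy b j (boundary j (Finsupp.single p 1))) =
      boundary j (Finsupp.single p 1) - sd b j (boundary j (Finsupp.single p 1)) := by
    cases j with
    | zero => simp [sdHomotopy, sd]
    | succ j =>
      have h := LinearMap.congr_fun (boundary_sdHomotopy j)
        (boundary (j + 1) (Finsupp.single p 1))
      have h' := LinearMap.congr_fun (boundary_boundary j) (Finsupp.single p 1)
      simp only [LinearMap.comp_apply, LinearMap.sub_apply, LinearMap.id_apply,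
        LinearMap.zero_apply] at h h'
      rw [h, h']
      simp
  have h := LinearMap.congr_fun (boundary_cone (b j p) j)
    (Finsupp.single p 1 - sdHomotopy b j (boundary j (Finsupp.single p 1)))
  simp only [LinearMap.comp_apply, LinearMap.sub_apply, LinearMap.id_apply] at h ⊢
  rw [sdHomotopy_single, h, sd_single, map_sub (boundary j), key]
  simp only [sub_sub_cancel]
  abel

lemma boundary_sd (j : ℕ) :
    boundary j ∘ₗ sd b (j + 1) = sd b j ∘ₗ boundary j := by
  have h (c : TupleChain V (j + 1)) := LinearMap.congr_fun (boundary_sdHomotopy b j) c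
  have hd (c : TupleChain V (j + 2)) := LinearMap.congr_fun (boundary_boundary j) c
  simp only [LinearMap.comp_apply, LinearMap.sub_apply, LinearMap.id_apply,
    LinearMap.zero_apply] at h hd
  ext1 p
  ext1
  simp only [LinearMap.comp_apply]
  generalize (Finsupp.lsingle p : ℝ →ₗ[ℝ] _) 1 = c
  have h1 : sd b (j + 1) c = c - boundary (j + 1) (sdHomotopy b (j + 1) c) -
      sdHomotopy b j (boundary j c) := by rw [h]; abel
  rw [h1, map_sub, map_sub, hd]
  cases j with
  | zero => simp [sdHomotopy, sd]
  | succ j =>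
    have h2 := LinearMap.congr_fun (boundary_sdHomotopy b j) (boundary (j + 1) c)
    have h3 := LinearMap.congr_fun (boundary_boundary j) c
    simp only [LinearMap.comp_apply, LinearMap.sub_apply, LinearMap.id_apply,
      LinearMap.zero_apply] at h2 h3
    rw [h2, h3]
    simp

/-- The chain homotopy between the identity and the `N`-fold subdivision operator. -/
noncomputable def sdIterHomotopy (N j : ℕ) : TupleChain V j →ₗ[ℝ] TupleChain V (j + 1) :=
  ∑ m ∈ Finset.range N, sdHomotopy b j ∘ₗ (sd b j ^ m)

lemma boundary_sd_pow (j m : ℕ) :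
    boundary j ∘ₗ (sd b (j + 1) ^ m) = (sd b j ^ m) ∘ₗ boundary j := by
  induction m with
  | zero => rfl
  | succ m ih =>
    rw [pow_succ, pow_succ, Module.End.mul_eq_comp, Module.End.mul_eq_comp, ← LinearMap.comp_assoc,
      ih, LinearMap.comp_assoc, boundary_sd, LinearMap.comp_assoc]

lemma boundary_sdIterHomotopy (N j : ℕ) :
    boundary (j + 1) ∘ₗ sdIterHomotopy b N (j + 1) =
      LinearMap.id - sd b (j + 1) ^ N - sdIterHomotopy b N j ∘ₗ boundary j := by
  induction N with
  | zero => exact LinearMap.ext fun c => by simp [sdIterHomotopy]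
  | succ N ih =>
    simp only [sdIterHomotopy, Finset.sum_range_succ] at ih ⊢
    rw [LinearMap.comp_add, ih, ← LinearMap.comp_assoc, boundary_sdHomotopy, LinearMap.add_comp,
      LinearMap.sub_comp, LinearMap.sub_comp, LinearMap.comp_assoc, LinearMap.comp_assoc,
      boundary_sd_pow, LinearMap.id_comp, pow_succ', Module.End.mul_eq_comp]
    abel

variable {b} {b' : ∀ j : ℕ, (Fin (j + 1) → W) → W}

lemma map_sd {f : V → W} (hf : ∀ j p, f (b j p) = b' j (f ∘ p)) (j : ℕ) :
    map f j ∘ₗ sd b j = sd b' j ∘ₗ map f j := by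
  induction j with
  | zero => rfl
  | succ j ih =>
    refine hom_ext fun p => ?_
    have h1 := LinearMap.congr_fun ih (boundary j (Finsupp.single p 1))
    have h2 := LinearMap.congr_fun (map_boundary f j) (Finsupp.single p 1)
    simp only [LinearMap.comp_apply] at h1 h2 ⊢
    rw [sd_single, map_cone, h1, h2, map_single, sd_single, hf]

lemma map_sdHomotopy {f : V → W} (hf : ∀ j p, f (b j p) = b' j (f ∘ p)) (j : ℕ) :
    map f (j + 1) ∘ₗ sdHomotopy b j = sdHomotopy b' j ∘ₗ map f j := by
  induction j with
  | zero => simp [sdHomotopy]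
  | succ j ih =>
    refine hom_ext fun p => ?_
    have h1 := LinearMap.congr_fun ih (boundary j (Finsupp.single p 1))
    have h2 := LinearMap.congr_fun (map_boundary f j) (Finsupp.single p 1)
    simp only [LinearMap.comp_apply] at h1 h2 ⊢
    rw [sdHomotopy_single, map_cone, map_sub, h1, h2, map_single, sdHomotopy_single, hf]

lemma map_sd_pow {f : V → W} (hf : ∀ j p, f (b j p) = b' j (f ∘ p)) (j m : ℕ) :
    map f j ∘ₗ (sd b j ^ m) = (sd b' j ^ m) ∘ₗ map f j := by
  induction m with
  | zero => rfl
  | succ m ih =>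
    rw [pow_succ, pow_succ, Module.End.mul_eq_comp, Module.End.mul_eq_comp, ← LinearMap.comp_assoc,
      ih, LinearMap.comp_assoc, map_sd hf, LinearMap.comp_assoc]

lemma map_sdIterHomotopy {f : V → W} (hf : ∀ j p, f (b j p) = b' j (f ∘ p)) (N j : ℕ) :
    map f (j + 1) ∘ₗ sdIterHomotopy b N j = sdIterHomotopy b' N j ∘ₗ map f j := by
  induction N with
  | zero => simp [sdIterHomotopy]
  | succ N ih =>
  simp only [sdIterHomotopy, Finset.sum_range_succ] at ih ⊢
  rw [LinearMap.comp_add, LinearMap.add_comp, ih]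
  congr 1
  rw [← LinearMap.comp_assoc, map_sdHomotopy hf, LinearMap.comp_assoc, map_sd_pow hf,
    LinearMap.comp_assoc]

end Subdivision

section Oscillation

/-- A linear map sends chains supported on `S` into `P` if it does so for the tuples in `S`. -/
lemma apply_mem_of_mem_supported {α M : Type*} [AddCommGroup M] [Module ℝ M]
    {F : (α →₀ ℝ) →ₗ[ℝ] M} {S : Set α} {P : Submodule ℝ M}
    (h : ∀ p ∈ S, F (Finsupp.single p 1) ∈ P) {c : α →₀ ℝ} (hc : c ∈ Finsupp.supported ℝ ℝ S) :
    F c ∈ P := by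
  rw [← Submodule.mem_comap]
  rw [Finsupp.supported_eq_span_single] at hc
  refine Submodule.span_le.2 ?_ hc
  rintro _ ⟨p, hp, rfl⟩
  exact h p hp

variable {κ : Type} (b : ∀ j : ℕ, (Fin (j + 1) → V) → V) (l : κ → V → ℝ)

/-- Tuples whose coordinates stay within the range of those of `p` and oscillate less than those of
`p`, by the factor governing barycentric subdivision. -/
def subordinate {j : ℕ} (p : Fin j → V) : Set (Fin j → V) :=
  {q | ∀ c, (∀ m, (∀ i, m ≤ l c (p i)) → ∀ a, m ≤ l c (q a)) ∧
    (∀ m, (∀ i, l c (p i) ≤ m) → ∀ a, l c (q a) ≤ m) ∧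
    ∀ D, (∀ i i', l c (p i) - l c (p i') ≤ D) →
      ∀ a a', l c (q a) - l c (q a') ≤ ((j : ℝ) - 1) / j * D}

lemma mean_sub_le {j : ℕ} (x : Fin (j + 1) → ℝ) (i₀ : Fin (j + 1)) {D : ℝ}
    (hD : ∀ i, x i - x i₀ ≤ D) :
    (∑ i, x i) / (j + 1) - x i₀ ≤ (((j + 1 : ℕ) : ℝ) - 1) / (j + 1 : ℕ) * D := by
  have hj : (0 : ℝ) < j + 1 := by positivity
  have h : ∑ i, (x i - x i₀) ≤ j * D := by
    rw [← Finset.add_sum_erase _ _ (Finset.mem_univ i₀), sub_self, zero_add]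
    refine (Finset.sum_le_card_nsmul _ _ D fun i _ => hD i).trans ?_
    simp
  rw [Finset.sum_sub_distrib] at h
  simp only [Finset.sum_const, Finset.card_univ, Fintype.card_fin, nsmul_eq_mul] at h
  push_cast at h ⊢
  rw [div_sub' hj.ne', div_mul_eq_mul_div, div_le_div_iff_of_pos_right hj]
  linarith

lemma sd_single_mem_supported (hb : ∀ j p c, l c (b j p) = (∑ i, l c (p i)) / (j + 1))
    {j : ℕ} (p : Fin j → V) :
    sd b j (Finsupp.single p 1) ∈ Finsupp.supported ℝ ℝ (subordinate l p) := by
  induction j with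
  | zero =>
    refine Finsupp.single_mem_supported ℝ _ fun c => ?_
    simp
  | succ j ih =>
    rw [sd_single, boundary_single, map_sum, map_sum]
    refine Submodule.sum_mem _ fun i _ => ?_
    rw [map_smul, map_smul]
    refine Submodule.smul_mem _ _ (apply_mem_of_mem_supported (fun q hq => ?_) (ih _))
    rw [cone_single]
    refine Finsupp.single_mem_supported ℝ _ fun c => ?_
    have hj : (0 : ℝ) < j + 1 := by positivity
    obtain ⟨h1, h2, h3⟩ := hq c
    have h1' (m) (hm : ∀ i, m ≤ l c (p i)) := h1 m fun i => hm _
    have h2' (m) (hm : ∀ i, l c (p i) ≤ m) := h2 m fun i => hm _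
    refine ⟨fun m hm a => ?_, fun m hm a => ?_, fun D hD => ?_⟩
    · refine Fin.cases ?_ (fun a => ?_) a
      · rw [Fin.cons_zero, hb, le_div_iff₀ hj]
        have := Finset.card_nsmul_le_sum Finset.univ (fun i => l c (p i)) m fun i _ => hm i
        simp only [Finset.card_univ, Fintype.card_fin, nsmul_eq_mul] at this
        push_cast at this
        linarith
      · simpa using h1' m hm a
    · refine Fin.cases ?_ (fun a => ?_) a
      · rw [Fin.cons_zero, hb, div_le_iff₀ hj]
        have := Finset.sum_le_card_nsmul Finset.univ (fun i => l c (p i)) m fun i _ => hm i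
        simp only [Finset.card_univ, Fintype.card_fin, nsmul_eq_mul] at this
        push_cast at this
        linarith
      · simpa using h2' m hm a
    · have hD0 : 0 ≤ D := by simpa using hD 0 0
      intro a a'
      refine Fin.cases ?_ (fun a => ?_) a <;> refine Fin.cases ?_ (fun a' => ?_) a'
      · simp only [sub_self]
        push_cast
        simp only [add_sub_cancel_right]
        positivity
      · obtain ⟨i₀, hi₀⟩ := Finite.exists_min fun i => l c (p i)
        have := mean_sub_le (fun i => l c (p i)) i₀ fun i => hD i i₀
        have := h1' _ hi₀ a'
        rw [Fin.cons_zero, Fin.cons_succ, hb]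
        linarith
      · obtain ⟨i₀, hi₀⟩ := Finite.exists_max fun i => l c (p i)
        have h := mean_sub_le (fun i => - l c (p i)) i₀ (D := D) fun i => by linarith [hD i₀ i]
        have := h2' _ hi₀ a
        rw [Finset.sum_neg_distrib, neg_div] at h
        rw [Fin.cons_zero, Fin.cons_succ, hb]
        linarith
      · simp only [Fin.cons_succ]
        refine (h3 D (fun i i' => hD _ _) a a').trans (mul_le_mul_of_nonneg_right ?_ hD0)
        cases j with
        | zero => simp
        | succ j =>
          rw [div_le_div_iff₀ (by positivity) (by positivity)]
          push_cast
          linarith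

/-- Tuples all of whose coordinates oscillate by at most `D`. -/
def smallTuples (j : ℕ) (D : ℝ) : Set (Fin j → V) :=
  {q | ∀ c a a', l c (q a) - l c (q a') ≤ D}

lemma sd_pow_mem_supported (hb : ∀ j p c, l c (b j p) = (∑ i, l c (p i)) / (j + 1))
    {j : ℕ} {p : Fin j → V} {D : ℝ} (hp : p ∈ smallTuples l j D) (N : ℕ) :
    (sd b j ^ N) (Finsupp.single p 1) ∈
      Finsupp.supported ℝ ℝ (smallTuples l j ((((j : ℝ) - 1) / j) ^ N * D)) := by
  induction N with
  | zero =>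
    simp only [pow_zero, one_mul, Module.End.one_apply]
    exact Finsupp.single_mem_supported ℝ _ hp
  | succ N ih =>
    rw [pow_succ' (sd b j), Module.End.mul_apply]
    refine apply_mem_of_mem_supported (fun q hq => ?_) ih
    refine Finsupp.supported_mono ?_ (sd_single_mem_supported b l hb q)
    intro q' hq' c a a'
    rw [pow_succ', mul_assoc]
    exact (hq' c).2.2 _ (hq c) a a'

end Oscillation

end TupleChain

/-! ### Affine simplices -/

section AffineSimplex

variable {ι κ μ : Type} [Fintype ι] [Fintype κ] [Fintype μ]

/-- The affine map between standard simplices with prescribed images of the vertices. -/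
noncomputable def affineSimplex (q : ι → stdSimplex ℝ κ) :
    C(stdSimplex ℝ ι, stdSimplex ℝ κ) where
  toFun t := ⟨fun c => ∑ a, t a * q a c,
    fun c => Finset.sum_nonneg fun a _ => mul_nonneg (t.2.1 a) ((q a).2.1 c), by
      rw [Finset.sum_comm]
      simp [← Finset.mul_sum]⟩
  continuous_toFun := by
    refine Continuous.subtype_mk (continuous_pi fun c => continuous_finsetSum _ fun a _ => ?_) _
    exact ((continuous_apply a).comp continuous_subtype_val).mul continuous_const

lemma affineSimplex_apply (q : ι → stdSimplex ℝ κ) (t : stdSimplex ℝ ι) (c : κ) :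
    affineSimplex q t c = ∑ a, t a * q a c := rfl

lemma affineSimplex_comp (q : ι → stdSimplex ℝ κ) (r : μ → stdSimplex ℝ ι) :
    (affineSimplex q).comp (affineSimplex r) = affineSimplex (affineSimplex q ∘ r) := by
  ext t c
  simp only [ContinuousMap.comp_apply, affineSimplex_apply, Function.comp_apply, Finset.sum_mul,
    Finset.mul_sum]
  rw [Finset.sum_comm]
  simp only [mul_assoc]

lemma affineSimplex_vertex [DecidableEq ι] (q : ι → stdSimplex ℝ κ) (i : ι) :
    affineSimplex q (stdSimplex.vertex i) = q i := by
  ext c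
  simp [affineSimplex_apply, Pi.single_apply]

lemma affineSimplex_vertex_eq_id [DecidableEq ι] :
    affineSimplex (fun i : ι => (stdSimplex.vertex i : stdSimplex ℝ ι)) = ContinuousMap.id _ := by
  ext t c
  simp [affineSimplex_apply, Pi.single_apply]

lemma affineSimplex_vertex_comp [DecidableEq ι] (f : μ → ι) (t : stdSimplex ℝ μ) :
    affineSimplex (fun i : μ => (stdSimplex.vertex (f i) : stdSimplex ℝ ι)) t =
      stdSimplex.map f t := by
  ext c
  simp [affineSimplex_apply, FunOnFinite.linearMap_apply_apply, Pi.single_apply, Finset.sum_filter,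
    eq_comm]

/-- The barycenter of a nonempty tuple of points of a standard simplex. -/
noncomputable def baryPoint (j : ℕ) (p : Fin (j + 1) → stdSimplex ℝ κ) : stdSimplex ℝ κ :=
  affineSimplex p stdSimplex.barycenter

lemma baryPoint_apply (j : ℕ) (p : Fin (j + 1) → stdSimplex ℝ κ) (c : κ) :
    baryPoint j p c = (∑ i, p i c) / (j + 1) := by
  have h (i : Fin (j + 1)) : (stdSimplex.barycenter : stdSimplex ℝ (Fin (j + 1))) i =
      ((j : ℝ) + 1)⁻¹ := by
    refine (stdSimplex.barycenter_apply (𝕜 := ℝ) i).trans ?_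
    simp
  simp [baryPoint, affineSimplex_apply, h, ← Finset.mul_sum, div_eq_inv_mul]

lemma affineSimplex_baryPoint (q : ι → stdSimplex ℝ κ) (j : ℕ)
    (p : Fin (j + 1) → stdSimplex ℝ ι) :
    affineSimplex q (baryPoint j p) = baryPoint j (affineSimplex q ∘ p) := by
  rw [baryPoint, baryPoint, ← affineSimplex_comp, ContinuousMap.comp_apply]

lemma abs_affineSimplex_sub_le {q : ι → stdSimplex ℝ κ} {D : ℝ}
    (hq : ∀ c a a', q a c - q a' c ≤ D) (t t' : stdSimplex ℝ ι) (c : κ) :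
    |affineSimplex q t c - affineSimplex q t' c| ≤ D := by
  have key (t t' : stdSimplex ℝ ι) : affineSimplex q t c - affineSimplex q t' c ≤ D := by
    have h1 : affineSimplex q t c = ∑ a, ∑ a', t a * t' a' * q a c := by
      simp [affineSimplex_apply, mul_right_comm _ _ (q _ c), ← Finset.mul_sum]
    have h2 : affineSimplex q t' c = ∑ a, ∑ a', t a * t' a' * q a' c := by
      simp [affineSimplex_apply, mul_assoc, ← Finset.mul_sum, ← Finset.sum_mul]
    have h3 : D = ∑ a, ∑ a', t a * t' a' * D := by
      simp [← Finset.mul_sum, ← Finset.sum_mul]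
    rw [h1, h2, h3, ← Finset.sum_sub_distrib]
    refine Finset.sum_le_sum fun a _ => ?_
    rw [← Finset.sum_sub_distrib]
    refine Finset.sum_le_sum fun a' _ => ?_
    rw [← mul_sub]
    exact mul_le_mul_of_nonneg_left (hq c a a') (mul_nonneg (t.2.1 a) (t'.2.1 a'))
  exact abs_sub_le_iff.2 ⟨key t t', key t' t⟩

end AffineSimplex

/-! ### Subdivision of singular chains -/

namespace SingularChain

open Simplicial TupleChain

variable {X Y : TopCat.{0}}

/-- The singular simplex given by a continuous map. -/
noncomputable abbrev simplex {k : ℕ} (σ : C(stdSimplex ℝ (Fin (k + 1)), X)) :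
    (TopCat.toSSet.obj X) _⦋k⦌ :=
  (X.toSSetObjEquiv (Opposite.op ⦋k⦌)).symm σ

/-- The continuous map underlying a singular simplex. -/
noncomputable abbrev toMap {k : ℕ} (s : (TopCat.toSSet.obj X) _⦋k⦌) :
    C(stdSimplex ℝ (Fin (k + 1)), X) :=
  X.toSSetObjEquiv (Opposite.op ⦋k⦌) s

/-- The differential of the singular chain complex. -/
noncomputable def diff (X : TopCat.{0}) (k : ℕ) :
    ((TopCat.toSSet.obj X) _⦋k + 1⦌ →₀ ℝ) →ₗ[ℝ] ((TopCat.toSSet.obj X) _⦋k⦌ →₀ ℝ) :=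
  ((singularChainComplexFunctor.obj X).d (k + 1) k).hom

lemma diff_single {k : ℕ} (s : (TopCat.toSSet.obj X) _⦋k + 1⦌) :
    diff X k (Finsupp.single s 1) =
      ∑ i : Fin (k + 2), (-1 : ℝ) ^ (i : ℕ) •
        Finsupp.single ((TopCat.toSSet.obj X).δ i s) 1 := by
  have h1 : diff X k = (∑ i : Fin (k + 2), (-1 : ℤ) ^ (i : ℕ) •
      (ModuleCat.free ℝ).map (↾((TopCat.toSSet.obj X).δ i))).hom :=
    congrArg ModuleCat.Hom.hom (AlgebraicTopology.alternatingFaceMapComplex_obj_d _ _)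
  have h2 : diff X k = ∑ i : Fin (k + 2), (-1 : ℤ) ^ (i : ℕ) •
      Finsupp.lmapDomain ℝ ℝ ((TopCat.toSSet.obj X).δ i) :=
    h1.trans (ModuleCat.hom_sum _ _)
  rw [h2, LinearMap.sum_apply]
  refine Finset.sum_congr rfl fun i _ => ?_
  rw [LinearMap.smul_apply, Finsupp.lmapDomain_apply, Finsupp.mapDomain_single,
    ← Int.cast_smul_eq_zsmul ℝ]
  simp

lemma δ_simplex {k : ℕ} (σ : C(stdSimplex ℝ (Fin (k + 2)), X)) (i : Fin (k + 2)) :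
    (TopCat.toSSet.obj X).δ i (simplex σ) =
      simplex (σ.comp (affineSimplex fun a => stdSimplex.vertex (i.succAbove a))) := by
  apply (X.toSSetObjEquiv (Opposite.op ⦋k⦌)).injective
  rw [Equiv.apply_symm_apply]
  ext t
  rw [ContinuousMap.comp_apply, affineSimplex_vertex_comp]
  rfl

/-- The singular chain obtained by mapping affine simplices along a continuous map. -/
noncomputable def push {k : ℕ} (σ : C(stdSimplex ℝ (Fin (k + 1)), X)) (j : ℕ) :
    TupleChain (stdSimplex ℝ (Fin (k + 1))) (j + 1) →ₗ[ℝ] ((TopCat.toSSet.obj X) _⦋j⦌ →₀ ℝ) :=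
  Finsupp.lmapDomain ℝ ℝ fun q => simplex (σ.comp (affineSimplex q))

lemma push_single {k j : ℕ} (σ : C(stdSimplex ℝ (Fin (k + 1)), X))
    (q : Fin (j + 1) → stdSimplex ℝ (Fin (k + 1))) :
    push σ j (Finsupp.single q 1) = Finsupp.single (simplex (σ.comp (affineSimplex q))) 1 := by
  simp [push]

lemma diff_push {k : ℕ} (σ : C(stdSimplex ℝ (Fin (k + 1)), X)) (j : ℕ) :
    diff X j ∘ₗ push σ (j + 1) = push σ j ∘ₗ boundary (j + 1) := by
  refine hom_ext fun q => ?_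
  rw [LinearMap.comp_apply, LinearMap.comp_apply, push_single, diff_single, boundary_single,
    map_sum]
  refine Finset.sum_congr rfl fun i _ => ?_
  rw [map_smul, push_single, δ_simplex, ContinuousMap.comp_assoc, affineSimplex_comp]
  simp only [Function.comp_def, affineSimplex_vertex]

lemma push_map {k l : ℕ} (σ : C(stdSimplex ℝ (Fin (k + 1)), X))
    (q : Fin (l + 1) → stdSimplex ℝ (Fin (k + 1))) (j : ℕ) :
    push σ j ∘ₗ TupleChain.map (affineSimplex q) (j + 1) = push (σ.comp (affineSimplex q)) j := by
  refine hom_ext fun r => ?_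
  rw [LinearMap.comp_apply, map_single, push_single, push_single, ContinuousMap.comp_assoc,
    affineSimplex_comp]

/-- The tuple of vertices of the standard simplex. -/
noncomputable def vertices (k : ℕ) : Fin (k + 1) → stdSimplex ℝ (Fin (k + 1)) :=
  fun i => stdSimplex.vertex i

/-- The `N`-fold barycentric subdivision of singular chains. -/
noncomputable def subdiv (X : TopCat.{0}) (N k : ℕ) :
    ((TopCat.toSSet.obj X) _⦋k⦌ →₀ ℝ) →ₗ[ℝ] ((TopCat.toSSet.obj X) _⦋k⦌ →₀ ℝ) :=
  Finsupp.lift _ ℝ _ fun s => push (toMap s) k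
    ((sd baryPoint (k + 1) ^ N) (Finsupp.single (vertices k) 1))

/-- The chain homotopy between the identity and `N`-fold barycentric subdivision. -/
noncomputable def subdivHomotopy (X : TopCat.{0}) (N k : ℕ) :
    ((TopCat.toSSet.obj X) _⦋k⦌ →₀ ℝ) →ₗ[ℝ] ((TopCat.toSSet.obj X) _⦋k + 1⦌ →₀ ℝ) :=
  Finsupp.lift _ ℝ _ fun s => push (toMap s) (k + 1)
    (sdIterHomotopy baryPoint N (k + 1) (Finsupp.single (vertices k) 1))

lemma subdivHomotopy_simplex {N k : ℕ} (σ : C(stdSimplex ℝ (Fin (k + 1)), X)) :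
    subdivHomotopy X N k (Finsupp.single (simplex σ) 1) =
      push σ (k + 1) (sdIterHomotopy baryPoint N (k + 1) (Finsupp.single (vertices k) 1)) := by
  simp [subdivHomotopy]

lemma diff_subdivHomotopy (N k : ℕ) (c : (TopCat.toSSet.obj X) _⦋k + 1⦌ →₀ ℝ) :
    diff X (k + 1) (subdivHomotopy X N (k + 1) c) =
      c - subdiv X N (k + 1) c - subdivHomotopy X N k (diff X k c) := by
  suffices diff X (k + 1) ∘ₗ subdivHomotopy X N (k + 1) =
      LinearMap.id - subdiv X N (k + 1) - subdivHomotopy X N k ∘ₗ diff X k from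
    LinearMap.congr_fun this c
  refine Finsupp.lhom_ext' fun s => LinearMap.ext_ring ?_
  obtain ⟨σ, rfl⟩ := (X.toSSetObjEquiv (Opposite.op ⦋k + 1⦌)).symm.surjective s
  have h1 := LinearMap.congr_fun (diff_push σ (k + 1))
    (sdIterHomotopy baryPoint N (k + 2) (Finsupp.single (vertices (k + 1)) 1))
  have h2 := LinearMap.congr_fun (boundary_sdIterHomotopy baryPoint N (k + 1))
    (Finsupp.single (vertices (k + 1)) 1)
  have h3 : push σ (k + 1) (Finsupp.single (vertices (k + 1)) 1) =
      Finsupp.single (simplex σ) 1 := by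
    rw [push_single]
    congr 2
    exact congrArg σ.comp affineSimplex_vertex_eq_id
  have h4 (i : Fin (k + 2)) :
      push σ (k + 1) (sdIterHomotopy baryPoint N (k + 1)
        (Finsupp.single (vertices (k + 1) ∘ i.succAbove) 1)) =
      subdivHomotopy X N k (Finsupp.single ((TopCat.toSSet.obj X).δ i (simplex σ)) 1) := by
    have hq : vertices (k + 1) ∘ i.succAbove =
        affineSimplex (vertices (k + 1) ∘ i.succAbove) ∘ vertices k := by
      ext1 a
      exact (affineSimplex_vertex _ a).symm
    have h := LinearMap.congr_fun (map_sdIterHomotopy (affineSimplex_baryPoint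
      (vertices (k + 1) ∘ i.succAbove)) N (k + 1)) (Finsupp.single (vertices k) 1)
    simp only [LinearMap.comp_apply] at h
    rw [δ_simplex, subdivHomotopy_simplex, hq, ← map_single, ← h, ← LinearMap.comp_apply, push_map]
    rfl
  simp only [LinearMap.comp_apply, LinearMap.sub_apply, LinearMap.id_apply,
    Finsupp.lsingle_apply] at h1 h2 ⊢
  rw [subdivHomotopy_simplex, h1, h2, map_sub, map_sub, h3, diff_single, boundary_single]
  simp only [map_sum, map_smul, h4]
  congr 2
  simp [subdiv]

end SingularChain

namespace SingularChain

open Simplicial TupleChain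

variable {X Y : TopCat.{0}}

lemma eventually_push_mem_supported (h : C(X, ℝ)) {ε : ℝ} (hε : 0 < ε) {k : ℕ}
    (σ : C(stdSimplex ℝ (Fin (k + 1)), X)) :
    ∀ᶠ N in Filter.atTop,
      push σ k ((sd baryPoint (k + 1) ^ N) (Finsupp.single (vertices k) 1)) ∈
        Finsupp.supported ℝ ℝ
          {s : (TopCat.toSSet.obj X) _⦋k⦌ | ∀ t t', h (toMap s t) - h (toMap s t') < ε} := by
  have hu : UniformContinuous (h.comp σ) :=
    CompactSpace.uniformContinuous_of_continuous (h.comp σ).continuous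
  obtain ⟨δ, hδ, hδ'⟩ := Metric.uniformContinuous_iff.1 hu ε hε
  have hk : (0 : ℝ) < (k + 1 : ℕ) := by positivity
  have hρ0 : (0 : ℝ) ≤ (((k + 1 : ℕ) : ℝ) - 1) / (k + 1 : ℕ) := by
    push_cast
    rw [add_sub_cancel_right]
    positivity
  have hρ1 : (((k + 1 : ℕ) : ℝ) - 1) / (k + 1 : ℕ) < 1 := by
    rw [div_lt_one hk]
    linarith
  have hlim := tendsto_pow_atTop_nhds_zero_of_lt_one hρ0 hρ1
  filter_upwards [hlim.eventually_lt_const hδ] with N hN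
  have hv : vertices k ∈ smallTuples (fun c (v : stdSimplex ℝ (Fin (k + 1))) => v c) (k + 1) 1 := by
    intro c a a'
    have h1 := (mem_Icc_of_mem_stdSimplex (vertices k a).2 c).2
    have h2 := (mem_Icc_of_mem_stdSimplex (vertices k a').2 c).1
    change (vertices k a).1 c - (vertices k a').1 c ≤ 1
    linarith
  have hs := sd_pow_mem_supported baryPoint
    (fun c (v : stdSimplex ℝ (Fin (k + 1))) => v c) (fun j p c => baryPoint_apply j p c) hv N
  refine apply_mem_of_mem_supported (fun q hq => ?_) hs
  rw [push_single]
  refine Finsupp.single_mem_supported ℝ _ fun t t' => ?_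
  rw [mul_one] at hq
  have hd : dist (affineSimplex q t) (affineSimplex q t') < δ := by
    refine lt_of_le_of_lt ?_ hN
    rw [Subtype.dist_eq, dist_pi_le_iff (pow_nonneg hρ0 N)]
    exact fun c => abs_affineSimplex_sub_le (fun c a a' => hq c a a') t t' c
  rw [toMap, simplex, Equiv.apply_symm_apply]
  exact (le_abs_self _).trans_lt (hδ' hd)

lemma exists_subdiv_mem_supported (h : C(X, ℝ)) {ε : ℝ} (hε : 0 < ε) {k : ℕ}
    (c : (TopCat.toSSet.obj X) _⦋k⦌ →₀ ℝ) :
    ∃ N, subdiv X N k c ∈ Finsupp.supported ℝ ℝ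
      {s : (TopCat.toSSet.obj X) _⦋k⦌ | ∀ t t', h (toMap s t) - h (toMap s t') < ε} := by
  have := (Filter.eventually_all_finset c.support).2 fun s _ =>
    eventually_push_mem_supported h hε (toMap s)
  obtain ⟨N, hN⟩ := this.exists
  refine ⟨N, ?_⟩
  rw [subdiv, Finsupp.lift_apply]
  exact Submodule.sum_mem _ fun s hs => Submodule.smul_mem _ _ (hN s hs)

/-- A chain map sending cycles to boundaries induces zero on homology. -/
lemma homologyMap_eq_zero {K L : ChainComplex (ModuleCat.{0} ℝ) ℕ} (φ : K ⟶ L) (k : ℕ)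
    (h : ∀ c : K.X (k + 1), (K.d (k + 1) k).hom c = 0 →
      ∃ e : L.X (k + 2), (L.d (k + 2) (k + 1)).hom e = (φ.f (k + 1)).hom c) :
    HomologicalComplex.homologyMap φ (k + 1) = 0 := by
  rw [← cancel_epi (K.homologyπ (k + 1)), HomologicalComplex.homologyπ_naturality,
    Limits.comp_zero]
  ext z
  have hz : (K.d (k + 1) k).hom ((K.iCycles (k + 1)).hom z) = 0 := by
    rw [← LinearMap.comp_apply, ← ModuleCat.hom_comp, K.iCycles_d]
    rfl
  obtain ⟨e, he⟩ := h _ hz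
  have hinj : Function.Injective (L.iCycles (k + 1)).hom :=
    (ModuleCat.mono_iff_injective _).1 inferInstance
  have hc : (HomologicalComplex.cyclesMap φ (k + 1)).hom z = (L.toCycles (k + 2) (k + 1)).hom e := by
    apply hinj
    rw [← LinearMap.comp_apply, ← ModuleCat.hom_comp, HomologicalComplex.cyclesMap_i,
      ← LinearMap.comp_apply (L.iCycles (k + 1)).hom, ← ModuleCat.hom_comp, L.toCycles_i]
    exact he.symm
  change (L.homologyπ (k + 1)).hom ((HomologicalComplex.cyclesMap φ (k + 1)).hom z) = 0
  rw [hc, ← LinearMap.comp_apply, ← ModuleCat.hom_comp, L.toCycles_comp_homologyπ]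
  rfl

/-- The map on singular chains induced by a continuous map. -/
noncomputable def chainMap (f : X ⟶ Y) (k : ℕ) :
    ((TopCat.toSSet.obj X) _⦋k⦌ →₀ ℝ) →ₗ[ℝ] ((TopCat.toSSet.obj Y) _⦋k⦌ →₀ ℝ) :=
  ((singularChainComplexFunctor.map f).f k).hom

lemma chainMap_single (f : X ⟶ Y) {k : ℕ} (s : (TopCat.toSSet.obj X) _⦋k⦌) :
    chainMap f k (Finsupp.single s 1) =
      Finsupp.single (simplex (f.hom.comp (toMap s))) 1 :=
  Finsupp.mapDomain_single

/-- If on each of the sets `{h > -ε}`, `{h < ε}` the pairs of maps `f₁, f₂` and `g₁, g₂` agree up to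
order, then `f₁ + f₂` and `g₁ + g₂` agree on homology. -/
theorem map_add_map_eq {f₁ f₂ g₁ g₂ : X ⟶ Y} (h : C(X, ℝ)) {ε : ℝ} (hε : 0 < ε)
    (hpos : ∀ x, -ε < h x → f₁ x = g₁ x ∧ f₂ x = g₂ x)
    (hneg : ∀ x, h x < ε → f₁ x = g₂ x ∧ f₂ x = g₁ x) (k : ℕ) :
    (singularHomologyFunctor (k + 1)).map f₁ + (singularHomologyFunctor (k + 1)).map f₂ =
      (singularHomologyFunctor (k + 1)).map g₁ + (singularHomologyFunctor (k + 1)).map g₂ := by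
  let F {X Y : TopCat.{0}} (f : X ⟶ Y) := singularChainComplexFunctor.map f
  have key : HomologicalComplex.homologyMap (F f₁ + F f₂ - (F g₁ + F g₂)) (k + 1) = 0 := by
    refine homologyMap_eq_zero _ k fun (c : (TopCat.toSSet.obj X) _⦋k + 1⦌ →₀ ℝ) hc => ?_
    let G (j : ℕ) := chainMap f₁ j + chainMap f₂ j - (chainMap g₁ j + chainMap g₂ j)
    have hG (c) : G (k + 1) (diff X (k + 1) c) = diff Y (k + 1) (G (k + 2) c) :=
      (LinearMap.congr_fun (congrArg ModuleCat.Hom.hom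
        ((F f₁ + F f₂ - (F g₁ + F g₂)).comm (k + 2) (k + 1))) c).symm
    obtain ⟨N, hN⟩ := exists_subdiv_mem_supported h hε c
    have hs : G (k + 1) (subdiv X N (k + 1) c) = 0 := by
      rw [← Submodule.mem_bot ℝ]
      refine apply_mem_of_mem_supported (fun s hs => ?_) hN
      rw [Submodule.mem_bot]
      simp only [G, LinearMap.sub_apply, LinearMap.add_apply, chainMap_single]
      by_cases ht : ∃ t, 0 ≤ h (toMap s t)
      · obtain ⟨t, ht⟩ := ht
        have hx (t') : -ε < h (toMap s t') := by linarith [hs t t']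
        have h1 : f₁.hom.comp (toMap s) = g₁.hom.comp (toMap s) :=
          ContinuousMap.ext fun t' => (hpos _ (hx t')).1
        have h2 : f₂.hom.comp (toMap s) = g₂.hom.comp (toMap s) :=
          ContinuousMap.ext fun t' => (hpos _ (hx t')).2
        rw [h1, h2, sub_self]
      · push Not at ht
        have hx (t') : h (toMap s t') < ε := (ht t').trans hε
        have h1 : f₁.hom.comp (toMap s) = g₂.hom.comp (toMap s) :=
          ContinuousMap.ext fun t' => (hneg _ (hx t')).1
        have h2 : f₂.hom.comp (toMap s) = g₁.hom.comp (toMap s) :=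
          ContinuousMap.ext fun t' => (hneg _ (hx t')).2
        rw [h1, h2]
        abel
    refine ⟨G (k + 2) (subdivHomotopy X N (k + 1) c), (hG _).symm.trans ?_⟩
    change G (k + 1) _ = G (k + 1) c
    have hc' : diff X k c = 0 := hc
    rw [diff_subdivHomotopy, hc', map_zero, sub_zero, map_sub, hs, sub_zero]
  rw [HomologicalComplex.homologyMap_sub, HomologicalComplex.homologyMap_add,
    HomologicalComplex.homologyMap_add] at key
  exact sub_eq_zero.1 key

/-- Homotopic maps induce the same map on homology. -/
theorem map_eq_of_homotopy {f g : X ⟶ Y} (H : TopCat.Homotopy f g) (k : ℕ) :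
    (singularHomologyFunctor k).map f = (singularHomologyFunctor k).map g :=
  (H.toSSet.toSimplicialObjectHomotopy.whiskerRight
    (ModuleCat.free ℝ)).toChainHomotopy.homologyMap_eq k

/-- Constant maps induce zero on homology in positive degrees. -/
theorem map_eq_zero_of_const {f : X ⟶ Y} (y : Y) (hf : ∀ x, f x = y) (k : ℕ) :
    (singularHomologyFunctor (k + 1)).map f = 0 := by
  let P := TopCat.of PUnit.{1}
  let i : X ⟶ P := TopCat.ofHom ⟨fun _ => PUnit.unit, continuous_const⟩
  let j : P ⟶ Y := TopCat.ofHom ⟨fun _ => y, continuous_const⟩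
  have hij : f = i ≫ j := by
    ext x
    exact hf x
  have hP : Limits.IsZero ((singularHomologyFunctor (k + 1)).obj P) := by
    refine HomologicalComplex.ExactAt.isZero_homology ?_
    refine HomologicalComplex.ExactAt.of_iso
      (ChainComplex.alternatingConst_exactAt ((ModuleCat.free ℝ).obj P) (k + 1) (by omega)) ?_
    exact ((AlgebraicTopology.alternatingFaceMapComplex _).mapIso
      (((SimplicialObject.whiskering _ _).obj _).mapIso
        (TopCat.toSSetIsoConst P) ≪≫ Functor.constComp _ _ _) ≪≫
      AlgebraicTopology.alternatingFaceMapComplexConst.app _).symm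
  rw [hij, Functor.map_comp, hP.eq_of_src ((singularHomologyFunctor (k + 1)).map j) 0,
    Limits.comp_zero]

end SingularChain

namespace UnitSphere

open SingularChain

variable {ι : Type} [Fintype ι]

/-- The unit sphere of `EuclideanSpace ℝ ι`. -/
abbrev sphere (ι : Type) [Fintype ι] : TopCat.{0} :=
  TopCat.of (Metric.sphere (0 : EuclideanSpace ℝ ι) 1)

/-- Rescaling a nowhere vanishing map into a Euclidean space to a map into the unit sphere. -/
noncomputable def normalize {X : Type} [TopologicalSpace X] (u : C(X, EuclideanSpace ℝ ι))
    (hu : ∀ x, u x ≠ 0) : C(X, Metric.sphere (0 : EuclideanSpace ℝ ι) 1) where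
  toFun x := ⟨‖u x‖⁻¹ • u x, by
    rw [mem_sphere_zero_iff_norm, norm_smul, norm_inv, norm_norm,
      inv_mul_cancel₀ (norm_ne_zero_iff.2 (hu x))]⟩
  continuous_toFun := by
    exact Continuous.subtype_mk ((u.continuous.norm.inv₀ fun x => norm_ne_zero_iff.2 (hu x)).smul
      u.continuous) _

lemma normalize_eq {X : Type} [TopologicalSpace X] {u : C(X, EuclideanSpace ℝ ι)}
    {hu : ∀ x, u x ≠ 0} {x : X} {y : Metric.sphere (0 : EuclideanSpace ℝ ι) 1}
    (h : u x = y) : normalize u hu x = y := by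
  have hy : ‖(y : EuclideanSpace ℝ ι)‖ = 1 := mem_sphere_zero_iff_norm.1 y.2
  exact Subtype.ext (by simp [normalize, h, hy])

/-- Maps joined by a nowhere vanishing straight line family have homotopic normalizations. -/
noncomputable def normalizeHomotopy {X : Type} [TopologicalSpace X]
    (u v : C(X, EuclideanSpace ℝ ι))
    (h : ∀ x (t : ℝ), 0 ≤ t → t ≤ 1 → (1 - t) • u x + t • v x ≠ 0)
    (hu : ∀ x, u x ≠ 0) (hv : ∀ x, v x ≠ 0) :
    ContinuousMap.Homotopy (normalize u hu) (normalize v hv) where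
  toContinuousMap := normalize
    ⟨fun p : unitInterval × X => (1 - (p.1 : ℝ)) • u p.2 + (p.1 : ℝ) • v p.2, by fun_prop⟩
    fun p => h p.2 p.1 p.1.2.1 p.1.2.2
  map_zero_left x := Subtype.ext (by simp [normalize])
  map_one_left x := Subtype.ext (by simp [normalize])

/-- The self-map of the sphere multiplying each coordinate by a sign. -/
noncomputable def signMap (s : ι → ℤˣ) : sphere ι ⟶ sphere ι :=
  TopCat.ofHom
    { toFun := fun x => ⟨WithLp.toLp 2 fun i => ((s i : ℤ) : ℝ) * x.1 i, by
        have hx := mem_sphere_zero_iff_norm.1 x.2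
        have hs : ∀ i, |((s i : ℤ) : ℝ)| = 1 := fun i => by
          rcases Int.units_eq_one_or (s i) with h | h <;> simp [h]
        rw [EuclideanSpace.norm_eq] at hx
        rw [mem_sphere_zero_iff_norm, EuclideanSpace.norm_eq]
        simpa [abs_mul, mul_pow, hs] using hx⟩
      continuous_toFun := by fun_prop }

lemma signMap_apply (s : ι → ℤˣ) (x : sphere ι) (i : ι) :
    (signMap s x).1 i = ((s i : ℤ) : ℝ) * x.1 i := rfl

lemma sphere_ext {x y : sphere ι} (h : ∀ i, x.1 i = y.1 i) : x = y :=
  Subtype.ext (WithLp.ofLp_injective 2 (funext h))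

lemma signMap_one : signMap (1 : ι → ℤˣ) = 𝟙 (sphere ι) := by
  ext x : 1
  exact sphere_ext fun i => by rw [signMap_apply]; simp

lemma signMap_mul (s t : ι → ℤˣ) : signMap (s * t) = signMap s ≫ signMap t := by
  ext x : 1
  refine sphere_ext fun i => ?_
  rw [TopCat.comp_app, signMap_apply, signMap_apply, signMap_apply]
  simp
  ring

section Coordinate

variable [DecidableEq ι] (i : ι)

/-- Applying `g` to the coordinate `i`. -/
noncomputable def coordVec (g : C(ℝ, ℝ)) : C(sphere ι, EuclideanSpace ℝ ι) where
  toFun x := WithLp.toLp 2 (Function.update x.1.ofLp i (g (x.1 i)))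
  continuous_toFun := by
    refine (PiLp.continuous_toLp 2 _).comp (Continuous.update ?_ i ?_) <;> fun_prop

lemma coordVec_apply (g : C(ℝ, ℝ)) (x : sphere ι) (j : ι) :
    coordVec i g x j = if j = i then g (x.1 i) else x.1 j := by
  simp [coordVec, Function.update_apply]

lemma exists_ne_zero_or (x : sphere ι) : (∃ j ≠ i, x.1 j ≠ 0) ∨ |x.1 i| = 1 := by
  by_contra! h
  have hx := mem_sphere_zero_iff_norm.1 x.2
  rw [EuclideanSpace.norm_eq, Finset.sum_eq_single i (fun j _ hj => by simp [h.1 j hj])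
    (by simp), Real.sqrt_sq (norm_nonneg _), Real.norm_eq_abs] at hx
  exact h.2 hx

lemma coordVec_ne_zero {g : C(ℝ, ℝ)} (hg : ∀ c, |c| = 1 → g c ≠ 0) (x : sphere ι) :
    coordVec i g x ≠ 0 := by
  intro h
  have h' : ∀ j, coordVec i g x j = 0 := fun j => by rw [h]; rfl
  rcases exists_ne_zero_or i x with ⟨j, hj, hx⟩ | hx
  · exact hx (by rw [← h' j, coordVec_apply, if_neg hj])
  · exact hg _ hx (by rw [← h' i, coordVec_apply, if_pos rfl])

/-- Applying `g` to the coordinate `i`, then rescaling to the sphere. -/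
noncomputable def coordMap (g : C(ℝ, ℝ)) (hg : ∀ c, |c| = 1 → g c ≠ 0) : sphere ι ⟶ sphere ι :=
  TopCat.ofHom (normalize (coordVec i g) (coordVec_ne_zero i hg))

variable {i} {g : C(ℝ, ℝ)} {hg : ∀ c, |c| = 1 → g c ≠ 0}

lemma coordMap_apply (x : sphere ι) (j : ι) : (coordMap i g hg x).1 j =
    ‖coordVec i g x‖⁻¹ * if j = i then g (x.1 i) else x.1 j := by
  rw [← coordVec_apply]
  rfl

lemma coordMap_eq_self {x : sphere ι} (h : g (x.1 i) = x.1 i) : coordMap i g hg x = x := by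
  refine normalize_eq (hu := coordVec_ne_zero i hg) (WithLp.ofLp_injective 2 (funext fun j => ?_))
  rw [coordVec_apply]
  split_ifs with hj
  · rw [h, hj]
  · rfl

/-- The reflection in the coordinate hyperplane orthogonal to the basis vector `i`. -/
noncomputable abbrev reflection (i : ι) : sphere ι ⟶ sphere ι :=
  signMap (Function.update 1 i (-1))

lemma reflection_apply (x : sphere ι) (j : ι) :
    (reflection i x).1 j = if j = i then -x.1 i else x.1 j := by
  rw [signMap_apply, Function.update_apply]
  split_ifs with h <;> simp [h]

lemma reflection_reflection (x : sphere ι) : reflection i (reflection i x) = x := by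
  refine sphere_ext fun j => ?_
  rw [reflection_apply, reflection_apply, reflection_apply]
  split_ifs <;> simp_all

lemma coordMap_eq_reflection {x : sphere ι} (h : g (x.1 i) = -x.1 i) :
    coordMap i g hg x = reflection i x := by
  refine normalize_eq (hu := coordVec_ne_zero i hg) (WithLp.ofLp_injective 2 (funext fun j => ?_))
  rw [coordVec_apply, h]
  exact (reflection_apply x j).symm

/-- If `g` preserves the signs of `1` and `-1`, then `coordMap i g` induces the identity. -/
lemma map_coordMap_eq_id (h : ∀ c, |c| = 1 → 0 < c * g c) (k : ℕ) :
    (singularHomologyFunctor k).map (coordMap i g hg) = 𝟙 _ := by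
  have hid : ∀ c : ℝ, |c| = 1 → ContinuousMap.id ℝ c ≠ 0 := fun c hc h0 => by
    simp_all
  have h1 : coordMap i (ContinuousMap.id ℝ) hid = 𝟙 (sphere ι) := by
    ext x : 1
    exact coordMap_eq_self rfl
  rw [← CategoryTheory.Functor.map_id, ← h1]
  refine (map_eq_of_homotopy (normalizeHomotopy _ _ ?_ (coordVec_ne_zero i hid)
    (coordVec_ne_zero i hg)) k).symm
  intro x t ht0 ht1 h0
  have h' : ∀ j, (1 - t) * x.1 j + t * (if j = i then g (x.1 i) else x.1 j) = 0 := fun j => by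
    have := congrArg (fun v : EuclideanSpace ℝ ι => v j) h0
    simpa [coordVec, Function.update_apply, -mul_ite] using this
  rcases exists_ne_zero_or i x with ⟨j, hj, hx⟩ | hx
  · have := h' j
    simp only [hj, if_false] at this
    exact hx (by linarith)
  · have h2 := h' i
    have h3 := h _ hx
    have h4 : x.1 i * x.1 i = 1 := by rw [← abs_mul_abs_self, hx, one_mul]
    simp only [if_true] at h2
    have h5 : (1 - t) * (x.1 i * x.1 i) + t * (x.1 i * g (x.1 i)) = 0 := by
      linear_combination x.1 i * h2
    rw [h4] at h5
    nlinarith [mul_nonneg ht0 h3.le, mul_pos h3 h3]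

/-- Folding the sphere onto a hemisphere. -/
noncomputable abbrev fold (i : ι) : sphere ι ⟶ sphere ι :=
  coordMap i ⟨fun c => |c|, continuous_abs⟩ fun c hc => by simp [hc]

lemma map_fold (k : ℕ) : (singularHomologyFunctor (k + 1)).map (fold i) = 0 := by
  let e : Metric.sphere (0 : EuclideanSpace ℝ ι) 1 := ⟨EuclideanSpace.single i 1, by simp⟩
  let u : C(sphere ι, EuclideanSpace ℝ ι) := ⟨fun _ => e.1, continuous_const⟩
  have hu : ∀ x, u x ≠ 0 := fun x h => by
    simpa [u, e] using congrArg (fun v : EuclideanSpace ℝ ι => v i) h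
  refine (map_eq_of_homotopy (g := TopCat.ofHom (normalize u hu))
    (normalizeHomotopy _ u ?_ (coordVec_ne_zero i fun c hc => by simp [hc]) hu) (k + 1)).trans
    (map_eq_zero_of_const e (fun x => normalize_eq (hu := hu) rfl) k)
  intro x t ht0 ht1 h0
  have h' : ∀ j, (1 - t) * (if j = i then |x.1 i| else x.1 j) + t * (if j = i then 1 else 0) = 0 :=
    fun j => by
      have := congrArg (fun v : EuclideanSpace ℝ ι => v j) h0
      simpa [coordVec, Function.update_apply, u, e] using this
  have hi := h' i
  simp only [if_true, mul_one] at hi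
  have h1 : 0 ≤ (1 - t) * |x.1 i| := mul_nonneg (by linarith) (abs_nonneg _)
  have ht : t = 0 := by linarith
  subst ht
  rcases exists_ne_zero_or i x with ⟨j, hj, hx⟩ | hx
  · exact hx (by simpa [hj] using h' j)
  · simp [hx] at hi

/-- A reflection acts as `-1` on the homology of a sphere in positive degrees. -/
theorem map_reflection (i : ι) (k : ℕ) :
    (singularHomologyFunctor (k + 1)).map (reflection i) = -𝟙 _ := by
  let g : C(ℝ, ℝ) := ⟨fun c => max (c - 1 / 2) 0 + min (c + 1 / 2) 0, by fun_prop⟩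
  have hpos : ∀ c, -(1 / 2) < c → 0 ≤ g c := fun c hc => by
    simp only [g, ContinuousMap.coe_mk]
    rw [min_eq_right (by linarith), add_zero]
    exact le_max_right _ _
  have hneg : ∀ c, c < 1 / 2 → g c ≤ 0 := fun c hc => by
    simp only [g, ContinuousMap.coe_mk]
    rw [max_eq_right (by linarith), zero_add]
    exact min_le_right _ _
  have hsign : ∀ c, |c| = 1 → 0 < c * g c := fun c hc => by
    rcases eq_or_eq_neg_of_abs_eq hc with rfl | rfl <;> norm_num [g]
  have hg : ∀ c, |c| = 1 → g c ≠ 0 := fun c hc h => by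
    simpa [h] using hsign c hc
  let f := coordMap i g hg
  have key := map_add_map_eq (f₁ := f) (f₂ := f ≫ reflection i) (g₁ := f ≫ fold i)
    (g₂ := f ≫ fold i ≫ reflection i) ⟨fun x : sphere ι => x.1 i, by fun_prop⟩ one_half_pos
    (fun x hx => by
      have hf : fold i (f x) = f x := coordMap_eq_self <| abs_of_nonneg <| by
        rw [coordMap_apply, if_pos rfl]
        exact mul_nonneg (inv_nonneg.2 (norm_nonneg _)) (hpos _ hx)
      exact ⟨hf.symm, congrArg (reflection i) hf.symm⟩)
    (fun x hx => by
      have hf : fold i (f x) = reflection i (f x) := coordMap_eq_reflection <| abs_of_nonpos <| by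
        rw [coordMap_apply, if_pos rfl]
        exact mul_nonpos_of_nonneg_of_nonpos (inv_nonneg.2 (norm_nonneg _)) (hneg _ hx)
      exact ⟨((congrArg (reflection i) hf).trans (reflection_reflection _)).symm, hf.symm⟩) k
  simp only [Functor.map_comp, map_fold, Limits.comp_zero, Limits.zero_comp, add_zero] at key
  rw [map_coordMap_eq_id hsign, Category.id_comp] at key
  exact (neg_eq_of_add_eq_zero_right key).symm

end Coordinate

/-- The antipodal map. -/
noncomputable abbrev antipodal (ι : Type) [Fintype ι] : sphere ι ⟶ sphere ι :=
  signMap (-1)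

/-- The antipodal map acts as `(-1) ^ m` on the homology of the unit sphere of `ℝ ^ m` in positive
degrees. -/
theorem map_antipodal (k : ℕ) :
    (singularHomologyFunctor (k + 1)).map (antipodal ι) =
      ((-1 : ℤ) ^ Fintype.card ι) • 𝟙 ((singularHomologyFunctor (k + 1)).obj (sphere ι)) := by
  classical
  have key : ∀ s : Finset ι, (singularHomologyFunctor (k + 1)).map
      (signMap (∏ i ∈ s, Function.update 1 i (-1))) =
        ((-1 : ℤ) ^ s.card) • 𝟙 ((singularHomologyFunctor (k + 1)).obj (sphere ι)) := by
    intro s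
    induction s using Finset.induction_on with
    | empty => simp [signMap_one]
    | insert i s hi ih =>
      rw [Finset.prod_insert hi, signMap_mul, Functor.map_comp, ih, map_reflection,
        Finset.card_insert_of_notMem hi, pow_succ]
      simp
  have h : (∏ i : ι, Function.update (1 : ι → ℤˣ) i (-1)) = -1 := by
    funext j
    simp [Finset.prod_apply, Function.update_apply]
  rw [antipodal, ← h, key, Finset.card_univ]

end UnitSphere

namespace Matrix.specialOrthogonalGroup

open UnitSphere

variable {ι : Type} [Fintype ι] [DecidableEq ι]

lemma norm_toLp_mulVec (A : Matrix.specialOrthogonalGroup ι ℝ) (v : EuclideanSpace ℝ ι) :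
    ‖WithLp.toLp 2 ((A : Matrix ι ι ℝ).mulVec v.ofLp)‖ = ‖v‖ := by
  have hA : (A : Matrix ι ι ℝ)ᵀ * (A : Matrix ι ι ℝ) = 1 :=
    (Matrix.mem_orthogonalGroup_iff' ι ℝ).1 A.2.1
  have h : ‖WithLp.toLp 2 ((A : Matrix ι ι ℝ).mulVec v.ofLp)‖ ^ 2 = ‖v‖ ^ 2 := by
    rw [EuclideanSpace.real_norm_sq_eq, EuclideanSpace.real_norm_sq_eq]
    have h1 := Matrix.dotProduct_mulVec ((A : Matrix ι ι ℝ).mulVec v.ofLp) (A : Matrix ι ι ℝ) v.ofLp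
    rw [← Matrix.mulVec_transpose, Matrix.mulVec_mulVec, hA, Matrix.one_mulVec] at h1
    simpa [dotProduct, sq] using h1
  exact (sq_eq_sq₀ (norm_nonneg _) (norm_nonneg _)).1 h

/-- The orbit map through a basis vector is homotopic to its antipode: move the basis vector to
its negative along a great circle. -/
noncomputable def orbitHomotopy {i j : ι} (hij : i ≠ j)
    (θ : TopCat.of (Matrix.specialOrthogonalGroup ι ℝ) ⟶ sphere ι)
    (hθ : ∀ A, (θ A).1.ofLp = (A : Matrix ι ι ℝ).mulVec (EuclideanSpace.single i (1 : ℝ)).ofLp) :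
    TopCat.Homotopy θ (θ ≫ antipodal ι) where
  toFun p := ⟨WithLp.toLp 2 ((p.2 : Matrix ι ι ℝ).mulVec
    (Real.cos (Real.pi * p.1) • EuclideanSpace.single i (1 : ℝ) +
      Real.sin (Real.pi * p.1) • EuclideanSpace.single j (1 : ℝ)).ofLp), by
    rw [mem_sphere_zero_iff_norm, norm_toLp_mulVec,
      ← sq_eq_sq₀ (norm_nonneg _) zero_le_one, one_pow,
      norm_add_sq_real]
    simp [norm_smul, inner_smul_left, inner_smul_right, EuclideanSpace.inner_single_left, hij]⟩
  continuous_toFun := by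
    refine Continuous.subtype_mk ((PiLp.continuous_toLp 2 _).comp ?_) _
    refine Continuous.matrix_mulVec (continuous_subtype_val.comp continuous_snd) ?_
    fun_prop
  map_zero_left A := sphere_ext fun l => by
    have := congrFun (hθ A) l
    simpa using this.symm
  map_one_left A := sphere_ext fun l => by
    have := congrFun (hθ A) l
    refine Eq.trans ?_ ((signMap_apply _ _ l).trans (congrArg _ this)).symm
    simp [Matrix.mulVec_neg]

end Matrix.specialOrthogonalGroup

/-- the orbit map `θ_N : SO(2n+1) → S^{2n}`, `A ↦ A·e₁`, induces the zero map on
`2n`-th singular homology with real coefficients. -/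
theorem SO_odd_orbitMap_zero_on_homology
    (n : ℕ) (hn : 1 ≤ n)
    (θ : TopCat.of (Matrix.specialOrthogonalGroup (Fin (2 * n + 1)) ℝ) ⟶
      TopCat.of (Metric.sphere (0 : EuclideanSpace ℝ (Fin (2 * n + 1))) 1))
    (hθ : ∀ A : Matrix.specialOrthogonalGroup (Fin (2 * n + 1)) ℝ,
      Subtype.val (θ A) =
        (A : Matrix (Fin (2 * n + 1)) (Fin (2 * n + 1)) ℝ).mulVec
          (EuclideanSpace.single (⟨0, by omega⟩ : Fin (2 * n + 1)) (1 : ℝ))) :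
    (singularHomologyFunctor (2 * n)).map θ = 0 := by
  obtain ⟨k, hk⟩ : ∃ k, 2 * n = k + 1 := ⟨2 * n - 1, by omega⟩
  have hne : (⟨0, by omega⟩ : Fin (2 * n + 1)) ≠ ⟨1, by omega⟩ := by simp
  have ha : (singularHomologyFunctor (k + 1)).map (UnitSphere.antipodal (Fin (2 * n + 1))) =
      -𝟙 _ := by
    rw [UnitSphere.map_antipodal, Fintype.card_fin, Odd.neg_one_pow ⟨n, rfl⟩, neg_one_zsmul]
  have h := SingularChain.map_eq_of_homotopy
    (Matrix.specialOrthogonalGroup.orbitHomotopy hne θ hθ) (2 * n)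
  rw [Functor.map_comp, show (singularHomologyFunctor (2 * n)).map
    (UnitSphere.antipodal (Fin (2 * n + 1))) = -𝟙 _ from hk ▸ ha, Preadditive.comp_neg,
    Category.comp_id] at h
  have h2 : (2 : ℝ) • (singularHomologyFunctor (2 * n)).map θ = 0 := by
    rw [two_smul]
    exact eq_neg_iff_add_eq_zero.1 h
  exact (smul_eq_zero.1 h2).resolve_left two_ne_zero
end
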